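/- Let d ≥ 2. For every constant C_0 > 0 there exists ε_0 ∈ (0,1), depending only on d and C_0, with the following property. Let 0 < ε < ε_0, μ_ε = ε^{−(d−1)}, N ≥ 1, and let Φ_N : 𝔻^N → ℝ be a symmetric measurable function with sup_{x_N ∈ 𝕋^d} ∫ |Φ_N(Z_N)| M^{⊗N}(V_N) dX_{N−1} dV_N ≤ C_0^N ρ_0 for some ρ_0 > 0. For Z_N ∈ 𝔻^N and (z̄_1,…,z̄_p) ∈ 𝔻^p, define the cumulant φ(Z_N, Z̄_p) := ∑_G ∏_{{a,b} ∈ E(G)} ( −1_{d(a,b) ≤ ε} ), where the sum runs over all connected simple graphs G on the (1+p)-element vertex set {0,1,…,p}, vertex 0 represents the block Z_N and vertex i ≥ 1 represents z̄_i, and d(a,b) is the minimum torus distance between the position components of the particles represented by vertices a and b. Then both series below converge absolutely and (1/Z^ε) ∑_{p≥0} (μ_ε^p/p!) ∫ 1_{D^ε_{N+p}}(Z_N, Z̄_p) M^{⊗(N+p)} Φ_N(Z_N) dZ_N dZ̄_p = ∑_{p≥0} (μ_ε^p/p!) ∫ M^{⊗(N+p)} φ(Z_N, Z̄_p) 1_{D^ε_N}(Z_N)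 Φ_N(Z_N) dZ_N dZ̄_p. -/

import Mathlib

open MeasureTheory Real
open scoped ENNReal BigOperators Classical

noncomputable section

/-- The unit `d`-dimensional torus `𝕋^d = ℝ^d/ℤ^d`, as a product of unit circles.
It carries its Haar probability measure. -/
abbrev Torus (d : ℕ) := Fin d → AddCircle (1 : ℝ)

/-- The Euclidean quotient distance on the torus `𝕋^d`. -/
noncomputable def torusDist {d : ℕ} (x y : Torus d) : ℝ :=
  Real.sqrt (∑ i, dist (x i) (y i) ^ 2)

/-- The one-particle phase space `𝔻 = 𝕋^d × ℝ^d`. -/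
abbrev Phase (d : ℕ) := Torus d × EuclideanSpace ℝ (Fin d)

/-- The standard Maxwellian `M(v) = (2π)^{−d/2} exp(−|v|²/2)`. -/
noncomputable def maxwellian (d : ℕ) (v : EuclideanSpace ℝ (Fin d)) : ℝ :=
  (2 * π) ^ (-(d : ℝ) / 2) * Real.exp (-‖v‖ ^ 2 / 2)

/-- The Boltzmann-Grad density `μ_ε = ε^{−(d−1)}`. -/
noncomputable def mu (d : ℕ) (ε : ℝ) : ℝ := ε ^ (-((d : ℤ) - 1))

/-- The hard-core exclusion: `Z_N ∈ D^ε_N` iff all mutual torus distances of the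
positions exceed `ε`. -/
def HardCore (d : ℕ) (ε : ℝ) {N : ℕ} (Z : Fin N → Phase d) : Prop :=
  ∀ i j, i ≠ j → ε < torusDist (Z i).1 (Z j).1

/-- The density `1_{D^ε_N}(Z_N) M^{⊗N}(V_N)` of the hard-sphere Gibbs weight. -/
noncomputable def hsWeight (d : ℕ) (ε : ℝ) {N : ℕ} (Z : Fin N → Phase d) : ℝ :=
  (if HardCore d ε Z then 1 else 0) * ∏ i, maxwellian d (Z i).2

/-- The grand canonical partition function
`Z^ε = 1 + ∑_{N≥1} (μ_ε^N/N!) ∫ 1_{D^ε_N} M^{⊗N} dZ_N` (the `N = 0` term of the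
series equals `1`). -/
noncomputable def partitionFn (d : ℕ) (ε : ℝ) : ℝ :=
  ∑' N : ℕ, mu d ε ^ N / N.factorial * ∫ Z : Fin N → Phase d, hsWeight d ε Z

/-- The `N`-fold measure on `𝔻^N` in which the position of the last particle is frozen
at `x` (Dirac mass) while all other positions and all velocities carry their Haar /
Lebesgue measures; it realizes the integration `dX_{N−1} dV_N` at fixed `x_N = x`. -/
noncomputable def lastFixed (d N : ℕ) (x : Torus d) : Measure (Fin N → Phase d) :=
  Measure.pi fun i =>
    if (i : ℕ) = N - 1 then (Measure.dirac x).prod (volume : Measure (EuclideanSpace ℝ (Fin d)))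
    else (volume : Measure (Phase d))

/-- The set of positions of the block indexed by `a ∈ {0,1,…,p}`: vertex `0`
represents the block `Z_N` (all `N` positions), and vertex `j + 1` represents the
single particle `z̄_j`. -/
def blockPos {d N p : ℕ} (Z : Fin N → Phase d) (Y : Fin p → Phase d)
    (a : Fin (p + 1)) : Set (Torus d) :=
  {x | ((a : ℕ) = 0 ∧ ∃ j : Fin N, x = (Z j).1) ∨
    ∃ j : Fin p, (a : ℕ) = (j : ℕ) + 1 ∧ x = (Y j).1}

/-- The minimum torus distance `d(a,b)` between the position components of the
particles represented by the vertices `a` and `b`. -/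
noncomputable def blockDist {d N p : ℕ} (Z : Fin N → Phase d) (Y : Fin p → Phase d)
    (a b : Fin (p + 1)) : ℝ :=
  sInf {r | ∃ u ∈ blockPos Z Y a, ∃ w ∈ blockPos Z Y b, r = torusDist u w}

/-- The cumulant `φ(Z_N, Z̄_p) = ∑_{G connected} ∏_{{a,b} ∈ E(G)} (−1_{d(a,b) ≤ ε})`,
the sum running over connected simple graphs on the `1+p` vertices `{0,1,…,p}` (vertex
`0` being the block `Z_N`); each edge contributes once (as its increasingly ordered
pair of endpoints). -/
noncomputable def cumulant (d : ℕ) (ε : ℝ) {N p : ℕ}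
    (Z : Fin N → Phase d) (Y : Fin p → Phase d) : ℝ :=
  ∑ G ∈ (Finset.univ : Finset (SimpleGraph (Fin (p + 1)))).filter (fun G => G.Connected),
    ∏ a : Fin (p + 1), ∏ b ∈ Finset.univ.filter (fun b => a < b ∧ G.Adj a b),
      -(if blockDist Z Y a b ≤ ε then (1 : ℝ) else 0)

/-- The real-valued indicator of a proposition. -/
def indic (P : Prop) : ℝ := if P then 1 else 0

theorem indic_true {P : Prop} (h : P) : indic P = 1 := if_pos h

theorem indic_and (P Q : Prop) : indic (P ∧ Q) = indic P * indic Q := by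
  by_cases hP : P <;> by_cases hQ : Q <;> simp [indic, hP, hQ]

theorem indic_nonneg (P : Prop) : 0 ≤ indic P := by
  unfold indic; split_ifs <;> norm_num

theorem indic_le_one (P : Prop) : indic P ≤ 1 := by
  unfold indic; split_ifs <;> norm_num

theorem prod_indic {α : Type*} (s : Finset α) (P : α → Prop) :
    ∏ i ∈ s, indic (P i) = indic (∀ i ∈ s, P i) := by
  simp only [indic]
  rw [Finset.prod_ite_zero]
  simp

section Ursell

variable {ι : Type*}

/-- The weight of hard-core configurations: no two distinct points of `S` overlap. -/
def coreWeight (o : ι → ι → Prop) (S : Finset ι) : ℝ :=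
  indic (∀ i ∈ S, ∀ j ∈ S, i ≠ j → ¬ o i j)

/-- The indicator that no point of `A` overlaps with a point of `S`. -/
def crossWeight (o : ι → ι → Prop) (A S : Finset ι) : ℝ :=
  indic (∀ i ∈ A, ∀ j ∈ S, ¬ o i j)

theorem coreWeight_empty (o : ι → ι → Prop) : coreWeight o ∅ = 1 :=
  indic_true (by simp)

theorem crossWeight_empty_left (o : ι → ι → Prop) (S : Finset ι) : crossWeight o ∅ S = 1 :=
  indic_true (by simp)

theorem coreWeight_map {κ : Type*} (e : κ ↪ ι) (o : ι → ι → Prop)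
    (S : Finset κ) :
    coreWeight o (S.map e) = coreWeight (fun i j => o (e i) (e j)) S := by
  unfold coreWeight
  congr 1
  apply propext
  simp

theorem crossWeight_map {κ : Type*} (e : κ ↪ ι) (o : ι → ι → Prop)
    (A S : Finset κ) :
    crossWeight o (A.map e) (S.map e) = crossWeight (fun i j => o (e i) (e j)) A S := by
  unfold crossWeight
  congr 1
  apply propext
  simp

theorem sum_prod_neg_indic (o : ι → ι → Prop) (a : ι) (S : Finset ι) :
    ∑ R ∈ S.powerset, ∏ j ∈ R, -indic (o a j) = crossWeight o {a} S := by
  rw [← Finset.prod_one_add]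
  have : ∀ j, 1 + -indic (o a j) = indic (¬ o a j) := by
    intro j
    by_cases h : o a j <;> simp [indic, h]
  simp only [this, prod_indic]
  unfold crossWeight
  simp

variable [DecidableEq ι]

theorem coreWeight_union {o : ι → ι → Prop} (ho : ∀ i j, o i j → o j i) {R T : Finset ι}
    (h : Disjoint R T) :
    coreWeight o (R ∪ T) = coreWeight o R * crossWeight o R T * coreWeight o T := by
  unfold coreWeight crossWeight
  rw [← indic_and, ← indic_and]
  congr 1
  apply propext
  constructor
  · intro H
    refine ⟨⟨fun i hi j hj => H i (by simp [hi]) j (by simp [hj]), fun i hi j hj => ?_⟩,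
      fun i hi j hj => H i (by simp [hi]) j (by simp [hj])⟩
    exact H i (by simp [hi]) j (by simp [hj])
      (fun e => Finset.disjoint_left.1 h hi (e ▸ hj))
  · rintro ⟨⟨h1, h2⟩, h3⟩ i hi j hj hij
    rcases Finset.mem_union.1 hi with hi | hi <;> rcases Finset.mem_union.1 hj with hj | hj
    · exact h1 i hi j hj hij
    · exact h2 i hi j hj
    · exact fun hh => h2 j hj i hi (ho _ _ hh)
    · exact h3 i hi j hj hij

theorem crossWeight_union_left (o : ι → ι → Prop) (A B S : Finset ι) :
    crossWeight o (A ∪ B) S = crossWeight o A S * crossWeight o B S := by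
  unfold crossWeight
  rw [← indic_and]
  congr 1
  apply propext
  simp only [Finset.mem_union, or_imp, forall_and]

theorem crossWeight_union_right (o : ι → ι → Prop) (A S T : Finset ι) :
    crossWeight o A (S ∪ T) = crossWeight o A S * crossWeight o A T := by
  unfold crossWeight
  rw [← indic_and]
  congr 1
  apply propext
  simp only [Finset.mem_union, or_imp, forall_and]

/-- The truncated weight of `S` relative to a root block `A`, defined by inverting the
convolution identity `∑_{R ⊆ S} ψ(A, R) h(S \ R) = w(A, S)`. -/
def truncWeight (o : ι → ι → Prop) (A S : Finset ι) : ℝ :=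
  crossWeight o A S * coreWeight o S -
    ∑ R ∈ S.ssubsets.attach, truncWeight o A R.1 * coreWeight o (S \ R.1)
termination_by S.card
decreasing_by exact Finset.card_lt_card (Finset.mem_ssubsets.1 R.2)

theorem truncWeight_eq (o : ι → ι → Prop) (A S : Finset ι) :
    truncWeight o A S = crossWeight o A S * coreWeight o S -
      ∑ R ∈ S.ssubsets, truncWeight o A R * coreWeight o (S \ R) := by
  rw [truncWeight, Finset.sum_attach S.ssubsets
    (fun R => truncWeight o A R * coreWeight o (S \ R))]

theorem sum_powerset_eq_add_ssubsets (K h : Finset ι → ℝ) (S : Finset ι) :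
    ∑ R ∈ S.powerset, K R * h (S \ R) = K S * h ∅ + ∑ R ∈ S.ssubsets, K R * h (S \ R) := by
  rw [Finset.ssubsets, ← Finset.add_sum_erase _ _ (Finset.mem_powerset_self S), Finset.sdiff_self]

theorem sum_truncWeight (o : ι → ι → Prop) (A S : Finset ι) :
    ∑ R ∈ S.powerset, truncWeight o A R * coreWeight o (S \ R) =
      crossWeight o A S * coreWeight o S := by
  rw [sum_powerset_eq_add_ssubsets, coreWeight_empty, truncWeight_eq]
  ring

/-- A set function is determined by its convolution with a set function that equals one at
the empty set. -/
theorem eq_of_convolution_eq {K K' h : Finset ι → ℝ} (h0 : h ∅ = 1)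
    (H : ∀ S, ∑ R ∈ S.powerset, K R * h (S \ R) = ∑ R ∈ S.powerset, K' R * h (S \ R))
    (S : Finset ι) : K S = K' S := by
  induction S using Finset.strongInduction with
  | H S ih =>
    have h1 := H S
    rw [sum_powerset_eq_add_ssubsets, sum_powerset_eq_add_ssubsets, h0,
      Finset.sum_congr rfl fun R hR => by rw [ih R (Finset.mem_ssubsets.1 hR)]] at h1
    linarith

theorem truncWeight_empty_left (o : ι → ι → Prop) (S : Finset ι) :
    truncWeight o ∅ S = if S = ∅ then 1 else 0 := by
  refine eq_of_convolution_eq (K' := fun S => if S = ∅ then 1 else 0) (coreWeight_empty o)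
    (fun S => ?_) S
  rw [sum_truncWeight, crossWeight_empty_left,
    Finset.sum_eq_single_of_mem ∅ (Finset.empty_mem_powerset S)]
  · simp
  · intro R _ hR
    simp [hR]

theorem map_sdiff_of_embedding {κ : Type*} [DecidableEq κ] (e : κ ↪ ι) (S R : Finset κ) :
    (S \ R).map e = S.map e \ R.map e := by
  simp [Finset.map_eq_image, Finset.image_sdiff _ _ e.injective]

theorem sum_powerset_map {κ : Type*} [DecidableEq κ] (e : κ ↪ ι) (S : Finset κ)
    (g : Finset ι → ℝ) : ∑ R ∈ (S.map e).powerset, g R = ∑ R ∈ S.powerset, g (R.map e) := by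
  rw [Finset.map_eq_image, Finset.powerset_image, Finset.sum_image]
  · simp [Finset.map_eq_image]
  · intro a _ b _ hab
    exact Finset.image_injective e.injective hab

theorem sum_truncWeight_map {κ : Type*} [DecidableEq κ] (e : κ ↪ ι) (o : ι → ι → Prop)
    (A : Finset ι) (S : Finset κ) :
    ∑ R ∈ S.powerset, truncWeight o A (R.map e) *
        coreWeight (fun i j => o (e i) (e j)) (S \ R) =
      crossWeight o A (S.map e) * coreWeight (fun i j => o (e i) (e j)) S := by
  rw [← coreWeight_map, ← sum_truncWeight, sum_powerset_map]
  refine Finset.sum_congr rfl fun R _ => ?_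
  rw [← coreWeight_map, map_sdiff_of_embedding]

theorem truncWeight_map {κ : Type*} [DecidableEq κ] (e : κ ↪ ι) (o : ι → ι → Prop)
    (A S : Finset κ) :
    truncWeight o (A.map e) (S.map e) = truncWeight (fun i j => o (e i) (e j)) A S := by
  refine eq_of_convolution_eq (K := fun S => truncWeight o (A.map e) (S.map e))
    (h := coreWeight (fun i j => o (e i) (e j))) (coreWeight_empty _) (fun S => ?_) S
  rw [sum_truncWeight_map, sum_truncWeight, crossWeight_map]

/-- The Kirkwood–Salsburg recursion: the edges from one root point `a` are expanded. -/
theorem truncWeight_insert {o : ι → ι → Prop} (ho : ∀ i j, o i j → o j i) (a : ι) (A S : Finset ι) :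
    truncWeight o (insert a A) S = ∑ R ∈ S.powerset, (∏ j ∈ R, -indic (o a j)) *
      (coreWeight o R * crossWeight o A R) * truncWeight o (A ∪ R) (S \ R) := by
  refine eq_of_convolution_eq (h := coreWeight o)
    (K' := fun S => ∑ R ∈ S.powerset, (∏ j ∈ R, -indic (o a j)) *
      (coreWeight o R * crossWeight o A R) * truncWeight o (A ∪ R) (S \ R))
    (coreWeight_empty o) (fun S => ?_) S
  rw [sum_truncWeight]
  simp only [Finset.sum_mul]
  calc crossWeight o (insert a A) S * coreWeight o S
      = ∑ R ∈ S.powerset, (∏ j ∈ R, -indic (o a j)) * (crossWeight o A S * coreWeight o S) := by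
        rw [← Finset.sum_mul, sum_prod_neg_indic, Finset.insert_eq, crossWeight_union_left]
        ring
    _ = ∑ R ∈ S.powerset, ∑ T ∈ (S \ R).powerset, (∏ j ∈ R, -indic (o a j)) *
          (coreWeight o R * crossWeight o A R) * truncWeight o (A ∪ R) T *
            coreWeight o ((S \ R) \ T) := by
        refine Finset.sum_congr rfl fun R hR => ?_
        have hRS : R ∪ (S \ R) = S := Finset.union_sdiff_of_subset (Finset.mem_powerset.1 hR)
        simp only [mul_assoc]
        simp only [← Finset.mul_sum]
        rw [sum_truncWeight, crossWeight_union_left]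
        conv_lhs => rw [← hRS]
        rw [coreWeight_union ho Finset.disjoint_sdiff, crossWeight_union_right]
        ring
    _ = _ := by
        rw [Finset.sum_sigma', Finset.sum_sigma']
        refine Finset.sum_bij' (fun x _ => ⟨x.1 ∪ x.2, x.1⟩) (fun x _ => ⟨x.2, x.1 \ x.2⟩)
          ?_ ?_ ?_ ?_ ?_
        · rintro ⟨R, T⟩ h
          simp only [Finset.mem_sigma, Finset.mem_powerset] at h ⊢
          exact ⟨Finset.union_subset h.1 (h.2.trans Finset.sdiff_subset),
            Finset.subset_union_left⟩
        · rintro ⟨T, R⟩ h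
          simp only [Finset.mem_sigma, Finset.mem_powerset] at h ⊢
          exact ⟨h.2.trans h.1, Finset.sdiff_subset_sdiff h.1 le_rfl⟩
        · rintro ⟨R, T⟩ h
          simp only [Finset.mem_sigma, Finset.mem_powerset] at h ⊢
          have : Disjoint T R := Finset.disjoint_of_subset_left h.2 Finset.sdiff_disjoint
          rw [Finset.union_sdiff_cancel_left this.symm]
        · rintro ⟨T, R⟩ h
          simp only [Finset.mem_sigma, Finset.mem_powerset] at h ⊢
          rw [Finset.union_sdiff_of_subset h.2]
        · rintro ⟨R, T⟩ h
          simp only [Finset.mem_sigma, Finset.mem_powerset] at h ⊢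
          have : Disjoint T R := Finset.disjoint_of_subset_left h.2 Finset.sdiff_disjoint
          rw [Finset.union_sdiff_cancel_left this.symm, sdiff_sdiff]
          rfl

end Ursell

section Bound

variable {ι X : Type*} [MeasurableSpace X]

theorem measurable_indic {α : Type*} [MeasurableSpace α] {P : α → Prop}
    (hP : MeasurableSet {a | P a}) : Measurable fun a => indic (P a) :=
  Measurable.ite hP measurable_const measurable_const

theorem measurable_indic_forall {α : Type*} [MeasurableSpace α] (A S : Finset ι)
    {P : ι → ι → α → Prop} (hP : ∀ i j, MeasurableSet {a | P i j a}) :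
    Measurable fun a => indic (∀ i ∈ A, ∀ j ∈ S, P i j a) := by
  refine measurable_indic ?_
  have : {a | ∀ i ∈ A, ∀ j ∈ S, P i j a} = ⋂ i ∈ A, ⋂ j ∈ S, {a | P i j a} := by
    ext; simp
  rw [this]
  exact Finset.measurableSet_biInter _ fun i _ => Finset.measurableSet_biInter _ fun j _ => hP i j

variable {D : X → X → Prop}

theorem measurableSet_overlap (hD : MeasurableSet {p : X × X | D p.1 p.2}) (i j : ι) :
    MeasurableSet {x : ι → X | D (x i) (x j)} :=
  hD.preimage (f := fun x : ι → X => (x i, x j))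
    ((measurable_pi_apply i).prodMk (measurable_pi_apply j))

theorem measurable_coreWeight (hD : MeasurableSet {p : X × X | D p.1 p.2}) (S : Finset ι) :
    Measurable fun x : ι → X => coreWeight (fun i j => D (x i) (x j)) S := by
  refine measurable_indic_forall S S (P := fun i j (x : ι → X) => i ≠ j → ¬ D (x i) (x j))
    fun i j => ?_
  by_cases h : i = j
  · simp [h]
  · simp only [ne_eq, h, not_false_eq_true, forall_const]
    exact (measurableSet_overlap hD i j).compl

theorem measurable_crossWeight (hD : MeasurableSet {p : X × X | D p.1 p.2}) (A S : Finset ι) :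
    Measurable fun x : ι → X => crossWeight (fun i j => D (x i) (x j)) A S :=
  measurable_indic_forall A S (P := fun i j (x : ι → X) => ¬ D (x i) (x j))
    fun i j => (measurableSet_overlap hD i j).compl

variable [DecidableEq ι]

theorem measurable_truncWeight (hD : MeasurableSet {p : X × X | D p.1 p.2}) (A S : Finset ι) :
    Measurable fun x : ι → X => truncWeight (fun i j => D (x i) (x j)) A S := by
  induction S using Finset.strongInduction with
  | H S ih =>
    simp only [truncWeight_eq _ A S]
    refine ((measurable_crossWeight hD A S).mul (measurable_coreWeight hD S)).sub
      (Finset.measurable_sum _ fun R hR => ?_)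
    exact (ih R (Finset.mem_ssubsets.1 hR)).mul (measurable_coreWeight hD _)

variable (ν : Measure X) [SigmaFinite ν]

theorem lmarginal_prod_eq {g : ι → X → ℝ≥0∞} (hg : ∀ i, Measurable (g i)) (S : Finset ι)
    (x : ι → X) :
    (∫⋯∫⁻_S, (fun x => ∏ i ∈ S, g i (x i)) ∂(fun _ => ν)) x = ∏ i ∈ S, ∫⁻ y, g i y ∂ν := by
  induction S using Finset.induction_on generalizing x with
  | empty => simp
  | insert i S hi ih =>
    have hm : ∀ T : Finset ι, Measurable fun x : ι → X => ∏ i ∈ T, g i (x i) := fun T =>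
      Finset.measurable_prod _ fun j _ => (hg j).comp (measurable_pi_apply j)
    rw [lmarginal_insert' _ (hm _) hi, Finset.prod_insert hi, ← ih x]
    have : (fun x : ι → X => ∫⁻ y, ∏ j ∈ insert i S, g j (Function.update x i y j) ∂ν) =
        fun x => (∫⁻ y, g i y ∂ν) * ∏ j ∈ S, g j (x j) := by
      funext x
      rw [← lintegral_mul_const _ (hg i)]
      refine lintegral_congr fun y => ?_
      rw [Finset.prod_insert hi, Function.update_self]
      congr 1
      refine Finset.prod_congr rfl fun j hj => ?_
      rw [Function.update_of_ne (ne_of_mem_of_not_mem hj hi)]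
    rw [this]
    unfold lmarginal
    exact lintegral_const_mul _ ((hm S).comp measurable_updateFinset)

theorem lintegral_pi_prod_eq [Fintype ι] {g : ι → X → ℝ≥0∞} (hg : ∀ i, Measurable (g i)) :
    ∫⁻ x, ∏ i, g i (x i) ∂(Measure.pi fun _ : ι => ν) = ∏ i, ∫⁻ y, g i y ∂ν := by
  by_cases hX : Nonempty (ι → X)
  · obtain ⟨x⟩ := hX
    rw [lintegral_eq_lmarginal_univ x, lmarginal_prod_eq ν hg]
  · rw [not_nonempty_iff] at hX
    obtain ⟨i, hi⟩ := isEmpty_pi.1 hX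
    rw [lintegral_of_isEmpty, Finset.prod_eq_zero (Finset.mem_univ i)]
    exact lintegral_of_isEmpty _ _

theorem lmarginal_union_prod_mul_le {g : X → ℝ≥0∞} (hg : Measurable g) {R T : Finset ι}
    (hRT : Disjoint R T) {t : (ι → X) → ℝ≥0∞} (ht : Measurable t) {C : ℝ≥0∞}
    (hC : ∀ x, (∫⋯∫⁻_T, t ∂(fun _ => ν)) x ≤ C) (x : ι → X) :
    (∫⋯∫⁻_R ∪ T, (fun x => (∏ j ∈ R, g (x j)) * t x) ∂(fun _ => ν)) x ≤
      (∫⁻ y, g y ∂ν) ^ R.card * C := by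
  have hm : Measurable fun x : ι → X => ∏ i ∈ R, g (x i) :=
    Finset.measurable_prod _ fun j _ => hg.comp (measurable_pi_apply j)
  rw [lmarginal_union (fun _ => ν) (fun x => (∏ j ∈ R, g (x j)) * t x) (hm.mul ht) hRT]
  calc _ ≤ (∫⋯∫⁻_R, (fun x => (∏ j ∈ R, g (x j)) * C) ∂(fun _ => ν)) x := by
        refine lmarginal_mono (fun z => ?_) x
        refine le_trans (le_of_eq ?_) (mul_le_mul_right (hC z) _)
        unfold lmarginal
        refine Eq.trans (lintegral_congr fun y => ?_)
          (lintegral_const_mul _ (ht.comp measurable_updateFinset))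
        dsimp only [Function.comp_apply]
        congr 1
        refine Finset.prod_congr rfl fun j hj => ?_
        rw [Function.updateFinset, dif_neg (Finset.disjoint_left.1 hRT hj)]
    _ = (∫⋯∫⁻_R, (fun x => ∏ j ∈ R, g (x j)) ∂(fun _ => ν)) x * C := by
        unfold lmarginal
        exact lintegral_mul_const _ (hm.comp measurable_updateFinset)
    _ = _ := by
        rw [lmarginal_prod_eq ν (g := fun _ => g) (fun _ => hg), Finset.prod_const]

theorem sum_choose_bound {b : ℝ} (hb : 0 ≤ b) (n p : ℕ) :
    ∑ k ∈ Finset.range (p + 1), p.choose k • (b ^ k *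
      ((p - k).factorial * (b * exp 1) ^ (p - k) * exp 1 ^ (n + k))) ≤
      p.factorial * (b * exp 1) ^ p * exp 1 ^ (n + 1) := by
  have key : ∀ k ∈ Finset.range (p + 1), p.choose k • (b ^ k *
      ((p - k).factorial * (b * exp 1) ^ (p - k) * exp 1 ^ (n + k))) =
      (p.factorial * (b * exp 1) ^ p * exp 1 ^ n) * (1 ^ k / k.factorial) := by
    intro k hk
    have hkp : k ≤ p := Nat.lt_succ_iff.1 (Finset.mem_range.1 hk)
    have h1 : (p.choose k : ℝ) * k.factorial * (p - k).factorial = p.factorial := by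
      exact_mod_cast Nat.choose_mul_factorial_mul_factorial hkp
    have h2 : (b * exp 1) ^ p = (b * exp 1) ^ k * (b * exp 1) ^ (p - k) := by
      rw [← pow_add, Nat.add_sub_cancel' hkp]
    rw [nsmul_eq_mul, ← h1, h2, mul_pow b (exp 1) k]
    field_simp
    ring
  rw [Finset.sum_congr rfl key, ← Finset.mul_sum]
  calc _ ≤ (p.factorial * (b * exp 1) ^ p * exp 1 ^ n) * exp 1 := by
        gcongr
        exact Real.sum_le_exp_of_nonneg zero_le_one _
    _ = _ := by ring

/-- The integral bound on the truncated weights coming from the Kirkwood–Salsburg recursion. -/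
theorem lmarginal_truncWeight_le (hD : MeasurableSet {p : X × X | D p.1 p.2})
    (hs : ∀ x y, D x y → D y x) {b : ℝ} (hb : 0 ≤ b)
    (hν : ∀ a, ν {y | D a y} ≤ ENNReal.ofReal b) {A S : Finset ι} (hAS : Disjoint A S)
    (x : ι → X) :
    (∫⋯∫⁻_S, (fun x => ‖truncWeight (fun i j => D (x i) (x j)) A S‖ₑ) ∂(fun _ => ν)) x ≤
      ENNReal.ofReal (S.card.factorial * (b * exp 1) ^ S.card * exp 1 ^ A.card) := by
  induction hn : A.card + S.card using Nat.strong_induction_on generalizing A S x with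
  | _ n ih =>
  rcases A.eq_empty_or_nonempty with rfl | ⟨a, ha⟩
  · simp only [truncWeight_empty_left]
    by_cases hS : S = ∅
    · simp [hS]
    · simp [hS, lmarginal]
  obtain ⟨A, haA, rfl⟩ : ∃ A', a ∉ A' ∧ A = insert a A' :=
    ⟨A.erase a, Finset.notMem_erase _ _, (Finset.insert_erase ha).symm⟩
  have haS : a ∉ S := Finset.disjoint_left.1 hAS ha
  have hAS' : Disjoint A S := Finset.disjoint_of_subset_left (Finset.subset_insert _ _) hAS
  have hcard : (insert a A).card = A.card + 1 := Finset.card_insert_of_notMem haA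
  let g : X → ℝ≥0∞ := fun y => ‖indic (D (x a) y)‖ₑ
  have hDa : MeasurableSet {y | D (x a) y} := measurable_prodMk_left hD
  have hg : Measurable g := (measurable_indic hDa).enorm
  have hgb : ∫⁻ y, g y ∂ν ≤ ENNReal.ofReal b := by
    refine le_trans (le_of_eq ?_) (hν (x a))
    rw [← lintegral_indicator_one hDa]
    refine lintegral_congr fun y => ?_
    by_cases h : D (x a) y <;> simp [g, indic, h]
  let t : Finset ι → (ι → X) → ℝ≥0∞ := fun R x =>
    ‖truncWeight (fun i j => D (x i) (x j)) (A ∪ R) (S \ R)‖ₑ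
  have ht : ∀ R, Measurable (t R) := fun R => (measurable_truncWeight hD _ _).enorm
  have hprod : ∀ R : Finset ι, Measurable fun x : ι → X => ∏ j ∈ R, g (x j) := fun R =>
    Finset.measurable_prod _ fun j _ => hg.comp (measurable_pi_apply j)
  calc _ ≤ (∫⋯∫⁻_S, (fun z => ∑ R ∈ S.powerset, (∏ j ∈ R, g (z j)) * t R z) ∂(fun _ => ν)) x := by
        unfold lmarginal
        refine lintegral_mono fun y => ?_
        set z := Function.updateFinset x S y with hz
        have hza : z a = x a := by rw [hz, Function.updateFinset, dif_neg haS]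
        dsimp only
        rw [truncWeight_insert (fun i j => hs _ _)]
        refine (enorm_sum_le _ _).trans (Finset.sum_le_sum fun R _ => ?_)
        rw [enorm_mul, enorm_mul]
        refine mul_le_mul_left ?_ _
        refine (mul_le_of_le_one_right zero_le ?_).trans (le_of_eq ?_)
        · rw [← enorm_one (G := ℝ)]
          unfold coreWeight crossWeight
          rw [← indic_and]
          rw [enorm_le_iff_norm_le, Real.norm_of_nonneg (indic_nonneg _), norm_one]
          exact indic_le_one _
        · have : ∀ s : Finset ι, ∀ h : ι → ℝ, ‖∏ j ∈ s, h j‖ₑ = ∏ j ∈ s, ‖h j‖ₑ := by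
            intro s h
            induction s using Finset.induction_on with
            | empty => simp
            | insert i s hi ih => rw [Finset.prod_insert hi, Finset.prod_insert hi, enorm_mul, ih]
          rw [this]
          simp only [enorm_neg, hza, g]
    _ = ∑ R ∈ S.powerset, (∫⋯∫⁻_S, (fun z => (∏ j ∈ R, g (z j)) * t R z) ∂(fun _ => ν)) x := by
        unfold lmarginal
        exact lintegral_finsetSum _ fun R _ =>
          ((hprod R).mul (ht R)).comp measurable_updateFinset
    _ ≤ ∑ R ∈ S.powerset, ENNReal.ofReal (b ^ R.card * ((S.card - R.card).factorial *
          (b * exp 1) ^ (S.card - R.card) * exp 1 ^ (A.card + R.card))) := by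
        refine Finset.sum_le_sum fun R hR => ?_
        have hRS := Finset.mem_powerset.1 hR
        have hle := Finset.card_le_card hRS
        have hAR : (A ∪ R).card = A.card + R.card := Finset.card_union_of_disjoint
          (Finset.disjoint_of_subset_right hRS hAS')
        have hSR : (S \ R).card = S.card - R.card := Finset.card_sdiff_of_subset hRS
        have hd : Disjoint (A ∪ R) (S \ R) := Finset.disjoint_union_left.2
          ⟨Finset.disjoint_of_subset_right Finset.sdiff_subset hAS', Finset.disjoint_sdiff⟩
        have := lmarginal_union_prod_mul_le ν hg (Finset.disjoint_sdiff (s := R) (t := S)) (ht R)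
          (fun y => ih ((A ∪ R).card + (S \ R).card) (by omega) hd y rfl) x
        rw [Finset.union_sdiff_of_subset hRS, hAR, hSR] at this
        refine this.trans ?_
        rw [ENNReal.ofReal_mul (p := b ^ R.card) (by positivity), ENNReal.ofReal_pow hb]
        gcongr
    _ ≤ _ := by
        rw [← ENNReal.ofReal_sum_of_nonneg (fun R _ => by positivity),
          Finset.sum_powerset_apply_card (fun k => b ^ k * ((S.card - k).factorial *
          (b * exp 1) ^ (S.card - k) * exp 1 ^ (A.card + k))), hcard]
        exact ENNReal.ofReal_le_ofReal (sum_choose_bound hb _ _)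

end Bound

section Graphs

variable {V : Type*}

section Component

variable [Fintype V]

/-- The set of vertices joined to `v` by a path with edges in `E`. -/
def component (v : V) (E : Finset (Sym2 V)) : Finset V :=
  Finset.univ.filter fun w => Relation.ReflTransGen (fun a b => s(a, b) ∈ E) v w

theorem mem_component {v w : V} {E : Finset (Sym2 V)} :
    w ∈ component v E ↔ Relation.ReflTransGen (fun a b => s(a, b) ∈ E) v w := by
  simp [component]

theorem self_mem_component (v : V) (E : Finset (Sym2 V)) : v ∈ component v E :=
  mem_component.2 Relation.ReflTransGen.refl

theorem mem_component_of_mem {v a b : V} {E : Finset (Sym2 V)} (ha : a ∈ component v E)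
    (h : s(a, b) ∈ E) : b ∈ component v E :=
  mem_component.2 ((mem_component.1 ha).tail h)

theorem component_subset {v : V} {E : Finset (Sym2 V)} {B : Finset V} (hv : v ∈ B)
    (h : ∀ a b, a ∈ B → s(a, b) ∈ E → b ∈ B) : component v E ⊆ B := by
  intro w hw
  induction mem_component.1 hw with
  | refl => exact hv
  | tail h1 h2 ih => exact h _ _ (ih (mem_component.2 h1)) h2

theorem component_mono {v : V} {E E' : Finset (Sym2 V)} (h : E ⊆ E') :
    component v E ⊆ component v E' := fun _ hw =>
  mem_component.2 (Relation.ReflTransGen.mono (fun _ _ hab => h hab) _ _ (mem_component.1 hw))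

end Component

variable [DecidableEq V]

/-- The unordered pairs of distinct points of `B`. -/
def pairs (B : Finset V) : Finset (Sym2 V) := B.sym2.filter (fun e => ¬ e.IsDiag)

theorem mk_mem_pairs {B : Finset V} {a b : V} : s(a, b) ∈ pairs B ↔ a ∈ B ∧ b ∈ B ∧ a ≠ b := by
  simp [pairs, and_assoc]

theorem pairs_mono {B C : Finset V} (h : B ⊆ C) : pairs B ⊆ pairs C := by
  intro e
  induction e using Sym2.ind with
  | _ a b => simp only [mk_mem_pairs]; exact fun ⟨h1, h2, h3⟩ => ⟨h h1, h h2, h3⟩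

theorem disjoint_pairs {B C : Finset V} (h : Disjoint B C) : Disjoint (pairs B) (pairs C) := by
  rw [Finset.disjoint_left]
  intro e
  induction e using Sym2.ind with
  | _ a b =>
    simp only [mk_mem_pairs]
    exact fun h1 h2 => Finset.disjoint_left.1 h h1.1 h2.1

variable [Fintype V]

theorem component_inter_pairs {v : V} {E : Finset (Sym2 V)} (hE : E ⊆ pairs Finset.univ) :
    component v (E ∩ pairs (component v E)) = component v E := by
  refine (component_mono Finset.inter_subset_left).antisymm fun w hw => ?_
  induction mem_component.1 hw with
  | refl => exact self_mem_component _ _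
  | tail h1 h2 ih =>
    have h1' := mem_component.2 h1
    exact mem_component_of_mem (ih h1') (Finset.mem_inter.2
      ⟨h2, mk_mem_pairs.2 ⟨h1', mem_component_of_mem h1' h2, (mk_mem_pairs.1 (hE h2)).2.2⟩⟩)

theorem component_union {v : V} {E E' : Finset (Sym2 V)} {C : Finset V} (hE' : E' ⊆ pairs C)
    (hC : Disjoint (component v E) C) : component v (E ∪ E') = component v E := by
  refine (component_subset (self_mem_component _ _) fun a b ha hab => ?_).antisymm
    (component_mono Finset.subset_union_left)
  rcases Finset.mem_union.1 hab with h | h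
  · exact mem_component_of_mem ha h
  · exact absurd (mk_mem_pairs.1 (hE' h)).1 (Finset.disjoint_left.1 hC ha)

/-- The sum of the edge weights over all connected graphs with vertex set `B`, rooted at `v`. -/
def connectedSum (F : Sym2 V → ℝ) (v : V) (B : Finset V) : ℝ :=
  ∑ E ∈ (pairs B).powerset.filter (fun E => component v E = B), ∏ e ∈ E, F e

theorem prod_one_add_eq_sum_connectedSum (F : Sym2 V → ℝ) {v : V} {B : Finset V} (hv : v ∈ B) :
    ∏ e ∈ pairs B, (1 + F e) = ∑ C ∈ B.powerset.filter (fun C => v ∈ C),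
      connectedSum F v C * ∏ e ∈ pairs (B \ C), (1 + F e) := by
  have hmaps : ∀ E ∈ (pairs B).powerset, component v E ∈ B.powerset.filter (fun C => v ∈ C) := by
    intro E hE
    rw [Finset.mem_powerset] at hE
    exact Finset.mem_filter.2 ⟨Finset.mem_powerset.2 (component_subset hv fun a b _ hab =>
      (mk_mem_pairs.1 (hE hab)).2.1), self_mem_component _ _⟩
  rw [Finset.prod_one_add, ← Finset.sum_fiberwise_of_maps_to hmaps]
  refine Finset.sum_congr rfl fun C hC => ?_
  obtain ⟨hCB, hvC⟩ := Finset.mem_filter.1 hC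
  rw [Finset.mem_powerset] at hCB
  rw [Finset.prod_one_add, connectedSum, Finset.sum_mul_sum, ← Finset.sum_product']
  have hdisj : Disjoint (pairs C) (pairs (B \ C)) := disjoint_pairs Finset.disjoint_sdiff
  refine Finset.sum_bij' (fun E _ => (E ∩ pairs C, E ∩ pairs (B \ C))) (fun E _ => E.1 ∪ E.2)
    ?_ ?_ ?_ ?_ ?_
  · intro E hE
    obtain ⟨hEB, rfl⟩ := Finset.mem_filter.1 hE
    rw [Finset.mem_powerset] at hEB
    simp only [Finset.mem_product, Finset.mem_filter, Finset.mem_powerset]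
    exact ⟨⟨Finset.inter_subset_right,
      component_inter_pairs (hEB.trans (pairs_mono (Finset.subset_univ _)))⟩,
      Finset.inter_subset_right⟩
  · rintro ⟨E, E'⟩ hE
    simp only [Finset.mem_product, Finset.mem_filter, Finset.mem_powerset] at hE ⊢
    obtain ⟨⟨h1, h2⟩, h3⟩ := hE
    refine ⟨Finset.union_subset (h1.trans (pairs_mono hCB))
      (h3.trans (pairs_mono Finset.sdiff_subset)), ?_⟩
    rw [component_union h3 (h2 ▸ Finset.disjoint_sdiff), h2]
  · intro E hE
    obtain ⟨hEB, rfl⟩ := Finset.mem_filter.1 hE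
    rw [Finset.mem_powerset] at hEB
    refine (Finset.union_subset Finset.inter_subset_left Finset.inter_subset_left).antisymm ?_
    intro e he
    induction e using Sym2.ind with
    | _ a b =>
      obtain ⟨ha, hb, hab⟩ := mk_mem_pairs.1 (hEB he)
      simp only [Finset.mem_union, Finset.mem_inter, mk_mem_pairs, Finset.mem_sdiff]
      by_cases hac : a ∈ component v E
      · exact Or.inl ⟨he, hac, mem_component_of_mem hac he, hab⟩
      · refine Or.inr ⟨he, ⟨ha, hac⟩, ⟨hb, fun hbc => hac ?_⟩, hab⟩
        exact mem_component_of_mem hbc (Sym2.eq_swap ▸ he)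
  · rintro ⟨E, E'⟩ hE
    simp only [Finset.mem_product, Finset.mem_filter, Finset.mem_powerset] at hE ⊢
    obtain ⟨⟨h1, -⟩, h3⟩ := hE
    rw [Finset.union_inter_distrib_right, Finset.union_inter_distrib_right,
      Finset.inter_eq_left.2 h1, Finset.inter_eq_left.2 h3,
      Finset.disjoint_iff_inter_eq_empty.1 (Finset.disjoint_of_subset_left h3 hdisj.symm),
      Finset.disjoint_iff_inter_eq_empty.1 (Finset.disjoint_of_subset_left h1 hdisj),
      Finset.union_empty, Finset.empty_union]
  · intro E hE
    obtain ⟨hEB, rfl⟩ := Finset.mem_filter.1 hE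
    rw [Finset.mem_powerset] at hEB
    rw [← Finset.prod_union]
    · refine Finset.prod_congr ?_ fun _ _ => rfl
      refine Finset.Subset.antisymm ?_
        (Finset.union_subset Finset.inter_subset_left Finset.inter_subset_left)
      intro e he
      induction e using Sym2.ind with
      | _ a b =>
        obtain ⟨ha, hb, hab⟩ := mk_mem_pairs.1 (hEB he)
        simp only [Finset.mem_union, Finset.mem_inter, mk_mem_pairs, Finset.mem_sdiff]
        by_cases hac : a ∈ component v E
        · exact Or.inl ⟨he, hac, mem_component_of_mem hac he, hab⟩
        · refine Or.inr ⟨he, ⟨ha, hac⟩, ⟨hb, fun hbc => hac ?_⟩, hab⟩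
          exact mem_component_of_mem hbc (Sym2.eq_swap ▸ he)
    · exact Finset.disjoint_of_subset_left Finset.inter_subset_right
        (Finset.disjoint_of_subset_right Finset.inter_subset_right hdisj)

end Graphs

section GraphsFin

/-- The sum over connected simple graphs equals the sum over edge sets reaching every vertex. -/
theorem sum_connected_eq_connectedSum {n : ℕ} [NeZero n] (F : Fin n → Fin n → ℝ)
    (F' : Sym2 (Fin n) → ℝ) (hF : ∀ a b, F' s(a, b) = F a b) :
    ∑ G ∈ (Finset.univ : Finset (SimpleGraph (Fin n))).filter (fun G => G.Connected),
      ∏ a : Fin n, ∏ b ∈ Finset.univ.filter (fun b => a < b ∧ G.Adj a b), F a b =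
    connectedSum F' 0 Finset.univ := by
  unfold connectedSum
  refine Finset.sum_bij' (fun G _ => G.edgeFinset)
    (fun E _ => SimpleGraph.fromEdgeSet (E : Set (Sym2 (Fin n)))) ?_ ?_ ?_ ?_ ?_
  · intro G hG
    simp only [Finset.mem_filter, Finset.mem_univ, true_and, Finset.mem_powerset] at hG ⊢
    constructor
    · intro e he
      induction e using Sym2.ind with
      | _ a b =>
        rw [SimpleGraph.mem_edgeFinset, SimpleGraph.mem_edgeSet] at he
        exact mk_mem_pairs.2 ⟨Finset.mem_univ _, Finset.mem_univ _, he.ne⟩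
    · rw [Finset.eq_univ_iff_forall]
      intro w
      have := (SimpleGraph.reachable_iff_reflTransGen 0 w).1 (hG.preconnected 0 w)
      rw [mem_component]
      simpa [SimpleGraph.mem_edgeFinset] using this
  · intro E hE
    simp only [Finset.mem_filter, Finset.mem_univ, true_and, Finset.mem_powerset] at hE ⊢
    obtain ⟨hE, hc⟩ := hE
    have h0 : ∀ w, (SimpleGraph.fromEdgeSet (E : Set (Sym2 (Fin n)))).Reachable 0 w := by
      intro w
      rw [SimpleGraph.reachable_iff_reflTransGen]
      have hw : w ∈ component 0 E := hc ▸ Finset.mem_univ w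
      refine Relation.ReflTransGen.mono (fun a b hab => ?_) _ _ (mem_component.1 hw)
      exact ⟨hab, (mk_mem_pairs.1 (hE hab)).2.2⟩
    have : Nonempty (Fin n) := ⟨0⟩
    exact ⟨fun u w => (h0 u).symm.trans (h0 w)⟩
  · intro G _
    simp
  · intro E hE
    simp only [Finset.mem_filter, Finset.mem_powerset] at hE
    ext e
    have hmem : ∀ (G : SimpleGraph (Fin n)) (_ : Fintype G.edgeSet),
        e ∈ G.edgeFinset ↔ e ∈ G.edgeSet := fun G _ => SimpleGraph.mem_edgeFinset
    refine (hmem _ _).trans ?_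
    induction e using Sym2.ind with
    | _ a b =>
      simp only [SimpleGraph.mem_edgeSet, SimpleGraph.fromEdgeSet_adj, Finset.mem_coe]
      exact ⟨fun h => h.1, fun h => ⟨h, (mk_mem_pairs.1 (hE.1 h)).2.2⟩⟩
  · intro G _
    rw [Finset.prod_sigma']
    refine Finset.prod_bij (fun x _ => s(x.1, x.2)) ?_ ?_ ?_ ?_
    · rintro ⟨a, b⟩ h
      simp only [Finset.mem_sigma, Finset.mem_univ, Finset.mem_filter, true_and] at h
      rw [SimpleGraph.mem_edgeFinset]
      exact h.2
    · rintro ⟨a, b⟩ h ⟨a', b'⟩ h' heq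
      simp only [Finset.mem_sigma, Finset.mem_univ, Finset.mem_filter, true_and] at h h'
      rcases Sym2.eq_iff.1 heq with ⟨rfl, rfl⟩ | ⟨rfl, rfl⟩
      · rfl
      · exact absurd h.1 h'.1.asymm
    · intro e he
      induction e using Sym2.ind with
      | _ a b =>
        rw [SimpleGraph.mem_edgeFinset, SimpleGraph.mem_edgeSet] at he
        rcases lt_or_gt_of_ne he.ne with h | h
        · exact ⟨⟨a, b⟩, by simp [h, he], rfl⟩
        · exact ⟨⟨b, a⟩, by simp [h, he.symm], Sym2.eq_swap⟩
    · rintro ⟨a, b⟩ _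
      exact (hF a b).symm

end GraphsFin

section Cumulant

variable {d : ℕ}

/-- Two particles overlap when their positions are at distance at most `ε`. -/
def Overlap (ε : ℝ) (z w : Phase d) : Prop := torusDist z.1 w.1 ≤ ε

theorem torusDist_comm (x y : Torus d) : torusDist x y = torusDist y x := by
  unfold torusDist
  simp only [dist_comm]

theorem overlap_symm {ε : ℝ} (z w : Phase d) (h : Overlap ε z w) : Overlap ε w z := by
  unfold Overlap at *
  rwa [torusDist_comm]

theorem blockDist_comm {N p : ℕ} (Z : Fin N → Phase d) (Y : Fin p → Phase d)
    (a b : Fin (p + 1)) : blockDist Z Y a b = blockDist Z Y b a := by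
  unfold blockDist
  congr 1
  ext r
  constructor <;> rintro ⟨u, hu, w, hw, rfl⟩ <;> exact ⟨w, hw, u, hu, torusDist_comm _ _⟩

theorem blockPos_zero {N p : ℕ} (Z : Fin N → Phase d) (Y : Fin p → Phase d) :
    blockPos Z Y 0 = Set.range fun i => (Z i).1 := by
  ext x
  simp [blockPos, eq_comm]

theorem blockPos_succ {N p : ℕ} (Z : Fin N → Phase d) (Y : Fin p → Phase d) (j : Fin p) :
    blockPos Z Y j.succ = {(Y j).1} := by
  ext x
  simp only [blockPos, Fin.val_succ, Set.mem_ofPred_eq, Set.mem_singleton_iff]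
  constructor
  · rintro (⟨h, -⟩ | ⟨k, h, rfl⟩)
    · omega
    · rw [Fin.ext (by omega : (j : ℕ) = k)]
  · rintro rfl
    exact Or.inr ⟨j, rfl, rfl⟩

theorem blockDist_succ_succ {N p : ℕ} (Z : Fin N → Phase d) (Y : Fin p → Phase d)
    (i j : Fin p) : blockDist Z Y i.succ j.succ = torusDist (Y i).1 (Y j).1 := by
  simp [blockDist, blockPos_succ]

theorem blockDist_zero_succ_le {N p : ℕ} (hN : 1 ≤ N) (Z : Fin N → Phase d)
    (Y : Fin p → Phase d) (j : Fin p) (ε : ℝ) :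
    blockDist Z Y 0 j.succ ≤ ε ↔ ∃ i, Overlap ε (Z i) (Y j) := by
  have hs : {r | ∃ u ∈ blockPos Z Y 0, ∃ w ∈ blockPos Z Y j.succ, r = torusDist u w} =
      Set.range fun i => torusDist (Z i).1 (Y j).1 := by
    ext r
    simp [blockPos_zero, blockPos_succ, eq_comm]
  have hfin := Set.finite_range fun i => torusDist (Z i).1 (Y j).1
  unfold blockDist
  rw [hs]
  constructor
  · intro h
    have : Nonempty (Fin N) := ⟨⟨0, hN⟩⟩
    obtain ⟨i, hi⟩ := (Set.range_nonempty fun i => torusDist (Z i).1 (Y j).1).csInf_mem hfin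
    exact ⟨i, hi.le.trans h⟩
  · rintro ⟨i, hi⟩
    exact (csInf_le hfin.bddBelow ⟨i, rfl⟩).trans hi

theorem prod_pairs_eq_coreWeight {V : Type*} [DecidableEq V] {q : V → V → Prop}
    {F : Sym2 V → ℝ} (hF : ∀ a b, F s(a, b) = -indic (q a b)) (B : Finset V) :
    ∏ e ∈ pairs B, (1 + F e) = coreWeight q B := by
  have h1 : ∀ e, 1 + F e = indic (1 + F e = 1) := by
    intro e
    induction e using Sym2.ind with
    | _ a b => by_cases h : q a b <;> simp [hF, indic, h]
  rw [Finset.prod_congr rfl fun e _ => h1 e, prod_indic]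
  unfold coreWeight
  congr 1
  apply propext
  have h2 : ∀ a b, 1 + F s(a, b) = 1 ↔ ¬ q a b := by
    intro a b
    by_cases h : q a b <;> simp [hF, indic, h]
  constructor
  · exact fun H a ha b hb hab => (h2 a b).1 (H _ (mk_mem_pairs.2 ⟨ha, hb, hab⟩))
  · intro H e he
    induction e using Sym2.ind with
    | _ a b =>
      obtain ⟨ha, hb, hab⟩ := mk_mem_pairs.1 he
      exact (h2 a b).2 (H a ha b hb hab)

theorem sum_filter_zero_mem {p : ℕ} (S : Finset (Fin p)) (g : Finset (Fin (p + 1)) → ℝ) :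
    ∑ C ∈ (insert 0 (S.map (Fin.succEmb p))).powerset.filter (fun C => 0 ∈ C), g C =
      ∑ R ∈ S.powerset, g (insert 0 (R.map (Fin.succEmb p))) := by
  symm
  refine Finset.sum_bij (fun R _ => insert 0 (R.map (Fin.succEmb p))) ?_ ?_ ?_ fun _ _ => rfl
  · intro R hR
    rw [Finset.mem_filter, Finset.mem_powerset]
    exact ⟨Finset.insert_subset_insert _ (Finset.map_subset_map.2 (Finset.mem_powerset.1 hR)),
      Finset.mem_insert_self _ _⟩
  · intro R _ R' _ h
    have h0 : ∀ R : Finset (Fin p), (0 : Fin (p + 1)) ∉ R.map (Fin.succEmb p) := by simp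
    have := congrArg (fun C => C.erase 0) h
    simpa [Finset.erase_insert (h0 _)] using this
  · intro C hC
    rw [Finset.mem_filter, Finset.mem_powerset] at hC
    refine ⟨S.filter fun j => j.succ ∈ C, Finset.mem_powerset.2 (Finset.filter_subset _ _), ?_⟩
    ext a
    refine Fin.cases ?_ (fun j => ?_) a
    · simp [hC.2]
    · have : j.succ ∈ C → j ∈ S := fun h => by simpa using hC.1 h
      simpa using this

/-- The graph cumulant is the truncated weight of the added particles relative to the block. -/
theorem cumulant_eq_truncWeight {N p : ℕ} (hN : 1 ≤ N) (ε : ℝ) (Z : Fin (N + p) → Phase d) :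
    cumulant d ε (Z ∘ Fin.castAdd p) (Z ∘ Fin.natAdd N) =
      truncWeight (fun i j => Overlap ε (Z i) (Z j)) (Finset.univ.map (Fin.castAddEmb p))
        (Finset.univ.map (Fin.natAddEmb N)) := by
  set Y := Z ∘ Fin.natAdd N with hY
  set X := Z ∘ Fin.castAdd p with hX
  set q : Fin (p + 1) → Fin (p + 1) → Prop := fun a b => blockDist X Y a b ≤ ε with hq
  set o : Fin (N + p) → Fin (N + p) → Prop := fun i j => Overlap ε (Z i) (Z j) with ho
  have hqs : ∀ a b, q a b → q b a := fun a b h => by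
    simp only [hq] at *
    rwa [blockDist_comm]
  let F : Sym2 (Fin (p + 1)) → ℝ := Sym2.lift ⟨fun a b => -indic (q a b), fun a b =>
    congrArg (fun P => -indic P) (propext ⟨hqs a b, hqs b a⟩)⟩
  have hF : ∀ a b, F s(a, b) = -indic (q a b) := fun a b => rfl
  have hcum : cumulant d ε X Y = connectedSum F 0 Finset.univ := by
    rw [← sum_connected_eq_connectedSum (fun a b => -indic (q a b)) F hF]
    unfold cumulant indic
    refine Finset.sum_congr rfl fun G _ => Finset.prod_congr rfl fun a _ =>
      Finset.prod_congr rfl fun b _ => ?_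
    congr
  have hss : ∀ i j : Fin p, q ((Fin.succEmb p) i) ((Fin.succEmb p) j) =
      o (Fin.natAddEmb N i) (Fin.natAddEmb N j) := fun i j => by
    simp only [hq, ho, Fin.coe_succEmb, blockDist_succ_succ]
    rfl
  have hcore : ∀ S : Finset (Fin p), coreWeight q (S.map (Fin.succEmb p)) =
      coreWeight (fun i j => o (Fin.natAddEmb N i) (Fin.natAddEmb N j)) S := fun S => by
    rw [coreWeight_map]
    simp only [hss]
  have hcross : ∀ S : Finset (Fin p), crossWeight q {0} (S.map (Fin.succEmb p)) =
      crossWeight o (Finset.univ.map (Fin.castAddEmb p)) (S.map (Fin.natAddEmb N)) := fun S => by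
    unfold crossWeight
    congr 1
    apply propext
    simp only [Finset.mem_singleton, forall_eq, Finset.mem_map, forall_exists_index, and_imp,
      forall_apply_eq_imp_iff₂, Finset.mem_univ, true_and, forall_apply_eq_imp_iff, hq, ho,
      Fin.coe_succEmb, blockDist_zero_succ_le hN, not_exists]
    exact ⟨fun h i j hj => h j hj i, fun h j hj i => h i j hj⟩
  have huniv : (Finset.univ : Finset (Fin (p + 1))) =
      insert 0 (Finset.univ.map (Fin.succEmb p)) := by
    ext a
    refine Fin.cases ?_ (fun j => ?_) a <;> simp
  rw [hcum, huniv]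
  refine eq_of_convolution_eq (K := fun S => connectedSum F 0 (insert 0 (S.map (Fin.succEmb p))))
    (K' := fun S => truncWeight o (Finset.univ.map (Fin.castAddEmb p)) (S.map (Fin.natAddEmb N)))
    (h := coreWeight (fun i j => o (Fin.natAddEmb N i) (Fin.natAddEmb N j)))
    (coreWeight_empty _) (fun S => ?_) Finset.univ
  have h0 : ∀ S : Finset (Fin p), Disjoint {(0 : Fin (p + 1))} (S.map (Fin.succEmb p)) := by
    simp
  rw [sum_truncWeight_map]
  have key := prod_one_add_eq_sum_connectedSum F (Finset.mem_insert_self 0 (S.map (Fin.succEmb p)))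
  rw [sum_filter_zero_mem, prod_pairs_eq_coreWeight hF, Finset.insert_eq,
    coreWeight_union hqs (h0 S), hcross, hcore] at key
  have h1 : coreWeight q {0} = 1 := indic_true (by simp)
  rw [h1, one_mul] at key
  rw [key]
  refine Finset.sum_congr rfl fun R _ => ?_
  have hsd : ({0} ∪ S.map (Fin.succEmb p)) \ insert 0 (R.map (Fin.succEmb p)) =
      (S \ R).map (Fin.succEmb p) := by
    ext a
    refine Fin.cases ?_ (fun j => ?_) a <;> simp
  rw [hsd, prod_pairs_eq_coreWeight hF, hcore]

end Cumulant

section Expansion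

variable {X : Type*} [MeasurableSpace X]

theorem measurePreserving_split {α β γ : Type*} [Fintype α] [Fintype β] [Fintype γ]
    (ν : Measure X) [SigmaFinite ν] (e : α ⊕ β ≃ γ) :
    MeasurePreserving (fun Z : γ → X => (fun a => Z (e (Sum.inl a)), fun b => Z (e (Sum.inr b))))
      (Measure.pi fun _ => ν) ((Measure.pi fun _ => ν).prod (Measure.pi fun _ => ν)) :=
  (measurePreserving_sumPiEquivProdPi (X := fun _ : α ⊕ β => X) fun _ => ν).comp
    (measurePreserving_piCongrLeft (fun _ : γ => ν) e).symm

theorem integral_split {α β γ : Type*} [Fintype α] [Fintype β] [Fintype γ]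
    (ν : Measure X) [SigmaFinite ν] (e : α ⊕ β ≃ γ) (G : (α → X) × (β → X) → ℝ) :
    ∫ Z : γ → X, G (fun a => Z (e (Sum.inl a)), fun b => Z (e (Sum.inr b)))
        ∂(Measure.pi fun _ => ν) =
      ∫ W, G W ∂((Measure.pi fun _ => ν).prod (Measure.pi fun _ => ν)) :=
  (measurePreserving_split ν e).integral_comp
    ((MeasurableEquiv.piCongrLeft (fun _ : γ => X) e).symm.trans
      (MeasurableEquiv.sumPiEquivProdPi fun _ : α ⊕ β => X)).measurableEmbedding G

theorem exists_truncWeight_le {ι : Type*} [Finite ι] [DecidableEq ι] (A S : Finset ι) :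
    ∃ C, ∀ o : ι → ι → Prop, ‖truncWeight o A S‖ ≤ C := by
  obtain ⟨C, hC⟩ := (Set.finite_range fun o : ι → ι → Prop => ‖truncWeight o A S‖).bddAbove
  exact ⟨C, fun o => hC ⟨o, rfl⟩⟩

theorem norm_coreWeight_le {ι : Type*} (o : ι → ι → Prop) (S : Finset ι) :
    ‖coreWeight o S‖ ≤ 1 := by
  unfold coreWeight
  rw [Real.norm_of_nonneg (indic_nonneg _)]
  exact indic_le_one _

theorem lintegral_mul_le_of_lmarginal_le {ι : Type*} [Fintype ι] [DecidableEq ι]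
    (ν : Measure X) [IsProbabilityMeasure ν] {S : Finset ι} {F t : (ι → X) → ℝ≥0∞}
    (hF : Measurable F) (ht : Measurable t)
    (hFS : ∀ x y, F (Function.updateFinset x S y) = F x) {C : ℝ≥0∞}
    (hC : ∀ x, (∫⋯∫⁻_S, t ∂(fun _ => ν)) x ≤ C) :
    ∫⁻ x, F x * t x ∂(Measure.pi fun _ => ν) ≤ (∫⁻ x, F x ∂(Measure.pi fun _ => ν)) * C := by
  rw [← lintegral_mul_const _ hF]
  refine lintegral_le_of_lmarginal_le S (hF.mul ht) (hF.mul_const C) fun x => ?_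
  unfold lmarginal
  simp only [hFS]
  rw [lintegral_const, measure_univ, mul_one]
  exact (lintegral_const_mul _ (ht.comp measurable_updateFinset)).trans_le
    (mul_le_mul_right (hC x) _)

/-- The equivalence splitting off from `N + p` particles the `q` added ones outside `R`. -/
def splitEquiv (N : ℕ) {p k q : ℕ} {R : Finset (Fin p)} (hk : R.card = k) (hq : Rᶜ.card = q) :
    Fin (N + k) ⊕ Fin q ≃ Fin (N + p) :=
  ((Equiv.sumCongr finSumFinEquiv.symm (Equiv.refl _)).trans (Equiv.sumAssoc _ _ _)).trans
    ((Equiv.sumCongr (Equiv.refl _) (finSumEquivOfFinset hk hq)).trans finSumFinEquiv)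

section splitEquiv

variable {N p k q : ℕ} {R : Finset (Fin p)} (hk : R.card = k) (hq : Rᶜ.card = q)

theorem splitEquiv_castAdd (i : Fin N) :
    splitEquiv N hk hq (Sum.inl (Fin.castAdd k i)) = Fin.castAdd p i := by
  simp [splitEquiv]

theorem splitEquiv_natAdd (j : Fin k) :
    splitEquiv N hk hq (Sum.inl (Fin.natAdd N j)) = Fin.natAdd N (R.orderEmbOfFin hk j) := by
  simp [splitEquiv]

theorem splitEquiv_inr (j : Fin q) :
    splitEquiv N hk hq (Sum.inr j) = Fin.natAdd N (Rᶜ.orderEmbOfFin hq j) := by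
  simp [splitEquiv]

end splitEquiv

theorem map_orderEmbOfFin {p k : ℕ} {R : Finset (Fin p)} (hk : R.card = k) :
    Finset.univ.map (R.orderEmbOfFin hk).toEmbedding = R := by
  simp

/-- The hard-core integral of `Φ` over `N + p` particles. -/
def coreIntegral (ν : Measure X) (D : X → X → Prop) {N : ℕ} (Φ : (Fin N → X) → ℝ) (p : ℕ) : ℝ :=
  ∫ Z : Fin (N + p) → X, coreWeight (fun i j => D (Z i) (Z j)) Finset.univ *
    Φ (Z ∘ Fin.castAdd p) ∂(Measure.pi fun _ => ν)

/-- The hard-core partition integral over `q` particles. -/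
def partitionIntegral (ν : Measure X) (D : X → X → Prop) (q : ℕ) : ℝ :=
  ∫ Z : Fin q → X, coreWeight (fun i j => D (Z i) (Z j)) Finset.univ ∂(Measure.pi fun _ => ν)

/-- The integral of `Φ` on the hard-core block against the truncated weight of `p` further
particles. -/
def truncIntegral (ν : Measure X) (D : X → X → Prop) {N : ℕ} (Φ : (Fin N → X) → ℝ) (p : ℕ) : ℝ :=
  ∫ Z : Fin (N + p) → X, truncWeight (fun i j => D (Z i) (Z j))
      (Finset.univ.map (Fin.castAddEmb p)) (Finset.univ.map (Fin.natAddEmb N)) *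
    (coreWeight (fun i j => D (Z (Fin.castAdd p i)) (Z (Fin.castAdd p j))) Finset.univ *
    Φ (Z ∘ Fin.castAdd p)) ∂(Measure.pi fun _ => ν)

theorem univ_eq_castAdd_union_natAdd (N p : ℕ) :
    (Finset.univ : Finset (Fin (N + p))) =
      Finset.univ.map (Fin.castAddEmb p) ∪ Finset.univ.map (Fin.natAddEmb N) := by
  ext i
  refine Fin.addCases (fun i => ?_) (fun i => ?_) i <;> simp

theorem disjoint_castAdd_natAdd (N p : ℕ) :
    Disjoint ((Finset.univ : Finset (Fin N)).map (Fin.castAddEmb p))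
      ((Finset.univ : Finset (Fin p)).map (Fin.natAddEmb N)) := by
  rw [Finset.disjoint_left]
  intro a ha hb
  simp only [Finset.mem_map, Finset.mem_univ, true_and] at ha hb
  obtain ⟨i, rfl⟩ := ha
  obtain ⟨j, hj⟩ := hb
  have := congrArg Fin.val hj
  simp at this
  omega

theorem coreWeight_univ_eq_sum {N p : ℕ} {o : Fin (N + p) → Fin (N + p) → Prop}
    (ho : ∀ i j, o i j → o j i) :
    coreWeight o Finset.univ = coreWeight (fun i j => o (Fin.castAdd p i) (Fin.castAdd p j))
      Finset.univ * ∑ R ∈ (Finset.univ : Finset (Fin p)).powerset,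
        truncWeight o (Finset.univ.map (Fin.castAddEmb p)) (R.map (Fin.natAddEmb N)) *
          coreWeight (fun i j => o (Fin.natAdd N i) (Fin.natAdd N j)) Rᶜ := by
  have h := sum_truncWeight_map (Fin.natAddEmb N) o (Finset.univ.map (Fin.castAddEmb p))
    Finset.univ
  simp only [Fin.natAddEmb_apply, ← Finset.compl_eq_univ_sdiff] at h
  rw [h, univ_eq_castAdd_union_natAdd, coreWeight_union ho (disjoint_castAdd_natAdd N p),
    coreWeight_map, coreWeight_map, mul_assoc]
  rfl

variable {ν : Measure X} [IsProbabilityMeasure ν] {D : X → X → Prop}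

theorem integrable_comp_castAdd {N : ℕ} {Φ : (Fin N → X) → ℝ}
    (hΦ : Integrable Φ (Measure.pi fun _ => ν)) (p : ℕ) :
    Integrable (fun Z : Fin (N + p) → X => Φ (Z ∘ Fin.castAdd p)) (Measure.pi fun _ => ν) :=
  (measurePreserving_split ν (finSumFinEquiv (m := N) (n := p))).integrable_comp_of_integrable
    (hΦ.comp_fst _)

theorem lintegral_comp_castAdd {N : ℕ} {F : (Fin N → X) → ℝ≥0∞} (hF : Measurable F) (p : ℕ) :
    ∫⁻ Z : Fin (N + p) → X, F (Z ∘ Fin.castAdd p) ∂(Measure.pi fun _ => ν) =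
      ∫⁻ Z, F Z ∂(Measure.pi fun _ => ν) := by
  have h := (measurePreserving_split ν (finSumFinEquiv (m := N) (n := p))).lintegral_comp
    (hF.comp measurable_fst)
  rw [lintegral_prod _ (hF.comp measurable_fst).aemeasurable] at h
  simpa [Function.comp_def] using h

theorem integral_truncWeight_mul_coreWeight {N p : ℕ} (Φ : (Fin N → X) → ℝ)
    (R : Finset (Fin p)) :
    ∫ Z : Fin (N + p) → X, truncWeight (fun i j => D (Z i) (Z j))
        (Finset.univ.map (Fin.castAddEmb p)) (R.map (Fin.natAddEmb N)) *
      (coreWeight (fun i j => D (Z (Fin.castAdd p i)) (Z (Fin.castAdd p j))) Finset.univ *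
        Φ (Z ∘ Fin.castAdd p)) *
      coreWeight (fun i j => D (Z (Fin.natAdd N i)) (Z (Fin.natAdd N j))) Rᶜ
        ∂(Measure.pi fun _ => ν) =
    truncIntegral ν D Φ R.card * partitionIntegral ν D (p - R.card) := by
  have hq : Rᶜ.card = p - R.card := by rw [Finset.card_compl, Fintype.card_fin]
  set e := splitEquiv N (rfl : R.card = R.card) hq with he
  unfold truncIntegral partitionIntegral
  rw [← integral_prod_mul, ← integral_split ν e]
  refine integral_congr_ae (ae_of_all _ fun Z => ?_)
  have hA : (Finset.univ.map (Fin.castAddEmb R.card)).map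
      (Function.Embedding.inl.trans e.toEmbedding) =
      (Finset.univ : Finset (Fin N)).map (Fin.castAddEmb p) := by
    rw [Finset.map_map]
    congr 1
    ext i
    simp [he, splitEquiv_castAdd]
  have hS : (Finset.univ.map (Fin.natAddEmb N)).map
      (Function.Embedding.inl.trans e.toEmbedding) = R.map (Fin.natAddEmb N) := by
    conv_rhs => rw [← map_orderEmbOfFin (rfl : R.card = R.card), Finset.map_map]
    rw [Finset.map_map]
    congr 1
    ext i
    simp [he, splitEquiv_natAdd]
  have ht := truncWeight_map (Function.Embedding.inl.trans e.toEmbedding)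
    (fun i j => D (Z i) (Z j)) (Finset.univ.map (Fin.castAddEmb R.card))
    (Finset.univ.map (Fin.natAddEmb N))
  rw [hA, hS] at ht
  have hc := coreWeight_map (Rᶜ.orderEmbOfFin hq).toEmbedding
    (fun i j => D (Z (Fin.natAdd N i)) (Z (Fin.natAdd N j))) Finset.univ
  rw [map_orderEmbOfFin] at hc
  simp only [ht, hc, Function.comp_def, he, splitEquiv_castAdd, splitEquiv_inr]
  rfl

end Expansion

theorem partitionIntegral_nonneg {X : Type*} [MeasurableSpace X] (ν : Measure X)
    (D : X → X → Prop) (q : ℕ) : 0 ≤ partitionIntegral ν D q :=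
  integral_nonneg fun _ => indic_nonneg _

section Series

variable {X : Type*} [MeasurableSpace X] {ν : Measure X} [IsProbabilityMeasure ν]
  {D : X → X → Prop} {N : ℕ} {Φ : (Fin N → X) → ℝ}

theorem measurable_coreWeight_comp (hD : MeasurableSet {q : X × X | D q.1 q.2})
    {ι κ : Type*} [Countable ι] (e : ι → κ) (S : Finset ι) :
    Measurable fun Z : κ → X => coreWeight (fun i j => D (Z (e i)) (Z (e j))) S :=
  (measurable_coreWeight hD S).comp
    (measurable_pi_lambda (fun (Z : κ → X) i => Z (e i)) fun i => measurable_pi_apply (e i))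

theorem integrable_block (hD : MeasurableSet {q : X × X | D q.1 q.2})
    (hΦ : Integrable Φ (Measure.pi fun _ => ν)) (p : ℕ) :
    Integrable (fun Z : Fin (N + p) → X =>
      coreWeight (fun i j => D (Z (Fin.castAdd p i)) (Z (Fin.castAdd p j))) Finset.univ *
        Φ (Z ∘ Fin.castAdd p)) (Measure.pi fun _ => ν) :=
  (integrable_comp_castAdd hΦ p).bdd_mul (measurable_coreWeight_comp hD _ _).aestronglyMeasurable
    (ae_of_all _ fun _ => norm_coreWeight_le _ _)

theorem coreIntegral_eq_sum (hD : MeasurableSet {q : X × X | D q.1 q.2})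
    (hs : ∀ x y, D x y → D y x) (hΦ : Integrable Φ (Measure.pi fun _ => ν)) (p : ℕ) :
    coreIntegral ν D Φ p = ∑ k ∈ Finset.range (p + 1),
      (p.choose k : ℝ) * (truncIntegral ν D Φ k * partitionIntegral ν D (p - k)) := by
  have hsum : coreIntegral ν D Φ p = ∑ R ∈ (Finset.univ : Finset (Fin p)).powerset,
      truncIntegral ν D Φ R.card * partitionIntegral ν D (p - R.card) := by
    simp only [← integral_truncWeight_mul_coreWeight]
    rw [← integral_finsetSum]
    · refine integral_congr_ae (ae_of_all _ fun Z => ?_)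
      dsimp only
      rw [coreWeight_univ_eq_sum fun i j => hs _ _, Finset.mul_sum, Finset.sum_mul]
      exact Finset.sum_congr rfl fun R _ => by ring
    · intro R _
      obtain ⟨C, hC⟩ := exists_truncWeight_le ((Finset.univ : Finset (Fin N)).map
        (Fin.castAddEmb p)) (R.map (Fin.natAddEmb N))
      exact ((integrable_block hD hΦ p).bdd_mul (measurable_truncWeight hD _ _).aestronglyMeasurable
        (ae_of_all _ fun _ => hC _)).mul_bdd (measurable_coreWeight_comp hD _ _).aestronglyMeasurable
        (ae_of_all _ fun _ => norm_coreWeight_le _ _)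
  rw [hsum, Finset.sum_powerset_apply_card
    fun k => truncIntegral ν D Φ k * partitionIntegral ν D (p - k)]
  simp

theorem lintegral_enorm_block_le (hΦm : Measurable Φ) (p : ℕ) :
    ∫⁻ Z : Fin (N + p) → X, ‖coreWeight
        (fun i j => D (Z (Fin.castAdd p i)) (Z (Fin.castAdd p j))) Finset.univ *
        Φ (Z ∘ Fin.castAdd p)‖ₑ ∂(Measure.pi fun _ => ν) ≤
      ∫⁻ Z, ‖Φ Z‖ₑ ∂(Measure.pi fun _ => ν) := by
  rw [← lintegral_comp_castAdd hΦm.enorm p]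
  refine lintegral_mono fun Z => ?_
  rw [enorm_mul]
  refine mul_le_of_le_one_left' ?_
  rw [← ofReal_norm]
  exact ENNReal.ofReal_le_one.2 (norm_coreWeight_le _ _)

theorem norm_coreIntegral_le (hΦm : Measurable Φ) (hΦ : Integrable Φ (Measure.pi fun _ => ν))
    (p : ℕ) : ‖coreIntegral ν D Φ p‖ ≤ ∫ Z, ‖Φ Z‖ ∂(Measure.pi fun _ => ν) := by
  have h : ∫ Z : Fin (N + p) → X, ‖Φ (Z ∘ Fin.castAdd p)‖ ∂(Measure.pi fun _ => ν) =
      ∫ Z, ‖Φ Z‖ ∂(Measure.pi fun _ => ν) := by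
    rw [integral_norm_eq_lintegral_enorm hΦ.1,
      integral_norm_eq_lintegral_enorm (integrable_comp_castAdd hΦ p).1,
      lintegral_comp_castAdd hΦm.enorm p]
  rw [← h]
  refine norm_integral_le_of_norm_le (integrable_comp_castAdd hΦ p).norm (ae_of_all _ fun Z => ?_)
  rw [norm_mul]
  exact mul_le_of_le_one_left (norm_nonneg _) (norm_coreWeight_le _ _)

theorem norm_truncIntegral_le (hD : MeasurableSet {q : X × X | D q.1 q.2})
    (hs : ∀ x y, D x y → D y x) {b : ℝ} (hb : 0 ≤ b)
    (hν : ∀ a, ν {y | D a y} ≤ ENNReal.ofReal b)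
    (hΦm : Measurable Φ) (hΦ : Integrable Φ (Measure.pi fun _ => ν)) (p : ℕ) :
    ‖truncIntegral ν D Φ p‖ ≤
      (∫ Z, ‖Φ Z‖ ∂(Measure.pi fun _ => ν)) * (p.factorial * (b * exp 1) ^ p * exp 1 ^ N) := by
  have hK := hΦ.2.ne
  rw [integral_norm_eq_lintegral_enorm hΦ.1]
  refine (norm_integral_le_lintegral_norm _).trans ?_
  have hB : (0 : ℝ) ≤ p.factorial * (b * exp 1) ^ p * exp 1 ^ N := by positivity
  rw [← ENNReal.toReal_ofReal hB, ← ENNReal.toReal_mul]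
  refine ENNReal.toReal_mono (ENNReal.mul_ne_top hK ENNReal.ofReal_ne_top) ?_
  simp only [ofReal_norm, enorm_mul _ (_ * _)]
  simp only [mul_comm ‖truncWeight _ _ _‖ₑ]
  refine (lintegral_mul_le_of_lmarginal_le ν
    (S := (Finset.univ : Finset (Fin p)).map (Fin.natAddEmb N))
    (F := fun Z : Fin (N + p) → X => ‖coreWeight
        (fun i j => D (Z (Fin.castAdd p i)) (Z (Fin.castAdd p j))) Finset.univ *
        Φ (Z ∘ Fin.castAdd p)‖ₑ)
    ?_ (measurable_truncWeight hD _ _).enorm ?_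
    (lmarginal_truncWeight_le ν hD hs hb hν (disjoint_castAdd_natAdd N p))).trans ?_
  · refine ((measurable_coreWeight_comp hD _ _).mul (hΦm.comp ?_)).enorm
    exact measurable_pi_lambda _ fun i => measurable_pi_apply _
  · intro x y
    have h : ∀ i : Fin N, Function.updateFinset x
        ((Finset.univ : Finset (Fin p)).map (Fin.natAddEmb N)) y (Fin.castAdd p i) =
        x (Fin.castAdd p i) := fun i => by
      refine dif_neg fun hi => ?_
      exact Finset.disjoint_left.1 (disjoint_castAdd_natAdd N p)
        (Finset.mem_map_of_mem (Fin.castAddEmb p) (Finset.mem_univ i)) hi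
    have h' : Function.updateFinset x
        ((Finset.univ : Finset (Fin p)).map (Fin.natAddEmb N)) y ∘ Fin.castAdd p =
        x ∘ Fin.castAdd p := funext h
    simp only [h, h']
  · simp only [Finset.card_map, Finset.card_univ, Fintype.card_fin]
    exact mul_le_mul_left (lintegral_enorm_block_le hΦm p) _

theorem partitionIntegral_zero : partitionIntegral ν D 0 = 1 := by
  have h : ∀ Z : Fin 0 → X, coreWeight (fun i j => D (Z i) (Z j)) Finset.univ = 1 :=
    fun Z => coreWeight_empty _
  unfold partitionIntegral
  simp only [h]
  simp

theorem norm_partitionIntegral_le (q : ℕ) : ‖partitionIntegral ν D q‖ ≤ 1 := by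
  refine (norm_integral_le_of_norm_le_const (ae_of_all _ fun Z => norm_coreWeight_le _ _)).trans ?_
  simp

theorem cluster_expansion (hD : MeasurableSet {q : X × X | D q.1 q.2})
    (hs : ∀ x y, D x y → D y x) {b : ℝ} (hb : 0 ≤ b)
    (hν : ∀ a, ν {y | D a y} ≤ ENNReal.ofReal b) {m : ℝ} (hm : 0 ≤ m)
    (hmb : m * b * exp 1 < 1)
    (hΦm : Measurable Φ) (hΦ : Integrable Φ (Measure.pi fun _ => ν)) :
    Summable (fun p : ℕ => |m ^ p / p.factorial * coreIntegral ν D Φ p|) ∧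
    Summable (fun p : ℕ => |m ^ p / p.factorial * truncIntegral ν D Φ p|) ∧
    (∑' q : ℕ, m ^ q / q.factorial * partitionIntegral ν D q)⁻¹ *
        (∑' p : ℕ, m ^ p / p.factorial * coreIntegral ν D Φ p) =
      ∑' p : ℕ, m ^ p / p.factorial * truncIntegral ν D Φ p := by
  have hexp := Real.summable_pow_div_factorial m
  have hnorm : ∀ p : ℕ, ‖m ^ p / p.factorial‖ = m ^ p / p.factorial := fun p =>
    Real.norm_of_nonneg (by positivity)
  have hI : Summable fun p : ℕ => ‖m ^ p / p.factorial * coreIntegral ν D Φ p‖ := by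
    refine Summable.of_nonneg_of_le (fun _ => norm_nonneg _) (fun p => ?_)
      (hexp.mul_right (∫ Z, ‖Φ Z‖ ∂(Measure.pi fun _ => ν)))
    rw [norm_mul, hnorm]
    exact mul_le_mul_of_nonneg_left (norm_coreIntegral_le hΦm hΦ p) (by positivity)
  have hQ : Summable fun q : ℕ => ‖m ^ q / q.factorial * partitionIntegral ν D q‖ := by
    refine Summable.of_nonneg_of_le (fun _ => norm_nonneg _) (fun p => ?_) hexp
    rw [norm_mul, hnorm]
    exact mul_le_of_le_one_right (by positivity) (norm_partitionIntegral_le p)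
  have hJ : Summable fun p : ℕ => ‖m ^ p / p.factorial * truncIntegral ν D Φ p‖ := by
    refine Summable.of_nonneg_of_le (fun _ => norm_nonneg _) (fun p => ?_)
      ((summable_geometric_of_lt_one (by positivity) hmb).mul_right
        ((∫ Z, ‖Φ Z‖ ∂(Measure.pi fun _ => ν)) * exp 1 ^ N))
    rw [norm_mul, hnorm]
    refine (mul_le_mul_of_nonneg_left (norm_truncIntegral_le hD hs hb hν hΦm hΦ p)
      (by positivity)).trans_eq ?_
    field_simp
    ring
  refine ⟨hI, hJ, ?_⟩
  have hpos : ∀ q : ℕ, 0 ≤ m ^ q / q.factorial * partitionIntegral ν D q := fun q =>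
    mul_nonneg (by positivity) (partitionIntegral_nonneg ν D q)
  have hne : (∑' q : ℕ, m ^ q / q.factorial * partitionIntegral ν D q) ≠ 0 := by
    have := hQ.of_norm.le_tsum 0 fun q _ => hpos q
    rw [partitionIntegral_zero] at this
    norm_num at this
    linarith
  rw [inv_mul_eq_iff_eq_mul₀ hne, mul_comm (∑' q : ℕ, m ^ q / q.factorial * _),
    tsum_mul_tsum_eq_tsum_sum_antidiagonal_of_summable_norm hJ hQ]
  refine tsum_congr fun p => ?_
  rw [coreIntegral_eq_sum hD hs hΦ, Finset.mul_sum, Finset.Nat.sum_antidiagonal_eq_sum_range_succ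
    fun k q => m ^ k / k.factorial * truncIntegral ν D Φ k *
      (m ^ q / q.factorial * partitionIntegral ν D q)]
  refine Finset.sum_congr rfl fun k hk => ?_
  have hkp : k ≤ p := Nat.lt_succ_iff.1 (Finset.mem_range.1 hk)
  rw [Nat.cast_choose ℝ hkp, ← Nat.add_sub_cancel' hkp, pow_add, Nat.add_sub_cancel' hkp]
  field_simp

end Series

section Gibbs

instance sigmaFinite_volume_phase (d : ℕ) : SigmaFinite (volume : Measure (Phase d)) :=
  inferInstance

variable {d : ℕ}

theorem maxwellian_nonneg (v : EuclideanSpace ℝ (Fin d)) : 0 ≤ maxwellian d v := by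
  unfold maxwellian
  positivity

theorem measurable_maxwellian : Measurable (maxwellian d) := by
  unfold maxwellian
  fun_prop

theorem integral_maxwellian : ∫ v, maxwellian d v = 1 := by
  have h := GaussianFourier.integral_rexp_neg_mul_sq_norm (V := EuclideanSpace ℝ (Fin d))
    (b := 1 / 2) (by norm_num)
  have h2 : ∀ v : EuclideanSpace ℝ (Fin d), -‖v‖ ^ 2 / 2 = -(1 / 2) * ‖v‖ ^ 2 := fun v => by ring
  unfold maxwellian
  simp only [h2]
  rw [integral_const_mul, h, finrank_euclideanSpace_fin, show π / (1 / 2) = 2 * π by ring,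
    ← Real.rpow_add (by positivity)]
  ring_nf
  simp

theorem lintegral_maxwellian :
    ∫⁻ v : EuclideanSpace ℝ (Fin d), ENNReal.ofReal (maxwellian d v) = 1 := by
  rw [← ofReal_integral_eq_lintegral_ofReal _ (ae_of_all _ maxwellian_nonneg),
    integral_maxwellian, ENNReal.ofReal_one]
  by_contra h
  have := integral_maxwellian (d := d)
  rw [integral_undef h] at this
  exact zero_ne_one this

/-- The one-particle equilibrium measure: uniform in position, Maxwellian in velocity. -/
def gibbs (d : ℕ) : Measure (Phase d) :=
  (volume : Measure (Torus d)).prod (volume.withDensity fun v => ENNReal.ofReal (maxwellian d v))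

instance : IsProbabilityMeasure
    ((volume : Measure (EuclideanSpace ℝ (Fin d))).withDensity
      fun v => ENNReal.ofReal (maxwellian d v)) :=
  ⟨by rw [withDensity_apply _ MeasurableSet.univ, setLIntegral_univ, lintegral_maxwellian]⟩

instance : IsProbabilityMeasure (volume : Measure (AddCircle (1 : ℝ))) :=
  ⟨by simp⟩

instance : IsProbabilityMeasure (gibbs d) := by
  unfold gibbs
  infer_instance

theorem gibbs_eq_withDensity :
    gibbs d = volume.withDensity fun z : Phase d => ENNReal.ofReal (maxwellian d z.2) :=
  prod_withDensity_right measurable_maxwellian.ennreal_ofReal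

theorem measurable_prod_maxwellian (n : ℕ) :
    Measurable fun Z : Fin n → Phase d => ∏ i, maxwellian d (Z i).2 :=
  Finset.measurable_prod _ fun i _ =>
    measurable_maxwellian.comp (measurable_snd.comp (measurable_pi_apply i))

theorem pi_gibbs_eq_withDensity (n : ℕ) :
    (Measure.pi fun _ : Fin n => gibbs d) = volume.withDensity fun Z : Fin n → Phase d =>
      ENNReal.ofReal (∏ i, maxwellian d (Z i).2) := by
  refine Measure.pi_eq fun s hs => ?_
  rw [withDensity_apply _ (MeasurableSet.univ_pi hs),
    ← lintegral_indicator (MeasurableSet.univ_pi hs)]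
  have h : ∀ Z : Fin n → Phase d, (Set.univ.pi s).indicator
      (fun Z : Fin n → Phase d => ENNReal.ofReal (∏ i, maxwellian d (Z i).2)) Z =
      ∏ i, (s i).indicator (fun z => ENNReal.ofReal (maxwellian d z.2)) (Z i) := fun Z => by
    by_cases hZ : ∀ i, Z i ∈ s i
    · rw [Set.indicator_of_mem (by simpa using hZ),
        ENNReal.ofReal_prod_of_nonneg fun i _ => maxwellian_nonneg _]
      exact Finset.prod_congr rfl fun i _ => (Set.indicator_of_mem (hZ i)
        fun z => ENNReal.ofReal (maxwellian d z.2)).symm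
    · rw [Set.indicator_of_notMem (by simpa using hZ)]
      obtain ⟨i, hi⟩ := not_forall.1 hZ
      exact (Finset.prod_eq_zero (Finset.mem_univ i) (Set.indicator_of_notMem hi _)).symm
  simp only [h]
  have hm : Measurable fun z : Phase d => ENNReal.ofReal (maxwellian d z.2) :=
    (measurable_maxwellian.comp measurable_snd).ennreal_ofReal
  refine (lintegral_pi_prod_eq volume fun i => hm.indicator (hs i)).trans ?_
  refine Finset.prod_congr rfl fun i _ => ?_
  rw [lintegral_indicator (hs i), gibbs_eq_withDensity, withDensity_apply _ (hs i)]

theorem integral_pi_gibbs (n : ℕ) (G : (Fin n → Phase d) → ℝ) :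
    ∫ Z, G Z ∂(Measure.pi fun _ => gibbs d) =
      ∫ Z : Fin n → Phase d, (∏ i, maxwellian d (Z i).2) * G Z := by
  rw [pi_gibbs_eq_withDensity, integral_withDensity_eq_integral_toReal_smul
    (measurable_prod_maxwellian n).ennreal_ofReal (ae_of_all _ fun _ => ENNReal.ofReal_lt_top)]
  refine integral_congr_ae (ae_of_all _ fun Z => ?_)
  dsimp only
  rw [ENNReal.toReal_ofReal (Finset.prod_nonneg fun i _ => maxwellian_nonneg _), smul_eq_mul]

theorem measurableSet_overlap_pair (ε : ℝ) :
    MeasurableSet {q : Phase d × Phase d | Overlap ε q.1 q.2} := by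
  have h : ∀ i, Measurable fun q : Phase d × Phase d => dist (q.1.1 i) (q.2.1 i) := fun i =>
    ((measurable_pi_apply i).comp (measurable_fst.comp measurable_fst)).dist
      ((measurable_pi_apply i).comp (measurable_fst.comp measurable_snd))
  have h2 : Measurable fun q : Phase d × Phase d => torusDist q.1.1 q.2.1 :=
    (Finset.measurable_sum _ fun i _ => (h i).pow_const 2).sqrt
  exact measurableSet_le h2 measurable_const

theorem dist_le_torusDist (x y : Torus d) (i : Fin d) : dist (x i) (y i) ≤ torusDist x y := by
  unfold torusDist
  refine Real.le_sqrt_of_sq_le ?_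
  exact Finset.single_le_sum (f := fun i => dist (x i) (y i) ^ 2) (fun _ _ => sq_nonneg _)
    (Finset.mem_univ i)

theorem gibbs_overlap_le {ε : ℝ} (hε : 0 ≤ ε) (z : Phase d) :
    gibbs d {w | Overlap ε z w} ≤ ENNReal.ofReal ((2 * ε) ^ d) := by
  have hsub : {w : Phase d | Overlap ε z w} ⊆
      (Set.univ.pi fun i => Metric.closedBall (z.1 i) ε) ×ˢ Set.univ := by
    intro w hw
    refine ⟨fun i _ => ?_, Set.mem_univ _⟩
    rw [Metric.mem_closedBall, dist_comm]
    exact (dist_le_torusDist z.1 w.1 i).trans hw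
  refine (measure_mono hsub).trans ?_
  rw [gibbs, Measure.prod_prod, measure_univ, mul_one, volume_pi_pi]
  simp only [AddCircle.volume_closedBall, Finset.prod_const, Finset.card_univ, Fintype.card_fin]
  rw [ENNReal.ofReal_pow (by positivity)]
  exact pow_le_pow_left' (ENNReal.ofReal_le_ofReal (min_le_right _ _)) d

theorem hardCore_ite_eq {n : ℕ} (ε : ℝ) (Z : Fin n → Phase d) :
    (if HardCore d ε Z then (1 : ℝ) else 0) =
      coreWeight (fun i j => Overlap ε (Z i) (Z j)) Finset.univ := by
  unfold coreWeight indic HardCore Overlap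
  simp

theorem lintegral_lintegral_lastFixed {n : ℕ} {f : (Fin (n + 1) → Phase d) → ℝ≥0∞}
    (hf : Measurable f) :
    ∫⁻ x, ∫⁻ Z, f Z ∂(lastFixed d (n + 1) x) = ∫⁻ Z, f Z := by
  set e := MeasurableEquiv.piFinSuccAbove (fun _ : Fin (n + 1) => Phase d) (Fin.last n)
  have hfe : Measurable fun q : Phase d × (Fin n → Phase d) => f (e.symm q) :=
    hf.comp e.symm.measurable
  have hg : Measurable fun z : Phase d => ∫⁻ W : Fin n → Phase d, f (e.symm (z, W)) :=
    hfe.lintegral_prod_right'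
  have hsplit : ∀ μ : Fin (n + 1) → Measure (Phase d), (∀ i, SigmaFinite (μ i)) →
      (fun j => μ ((Fin.last n).succAbove j)) = (fun _ => (volume : Measure (Phase d))) →
      ∫⁻ Z, f Z ∂(Measure.pi μ) =
        ∫⁻ z, (∫⁻ W : Fin n → Phase d, f (e.symm (z, W))) ∂(μ (Fin.last n)) := by
    intro μ _ hμ
    have h : ∫⁻ Z, f (e.symm (e Z)) ∂(Measure.pi μ) = ∫⁻ q, f (e.symm q)
        ∂((μ (Fin.last n)).prod (Measure.pi fun j => μ ((Fin.last n).succAbove j))) :=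
      (measurePreserving_piFinSuccAbove μ (Fin.last n)).lintegral_comp hfe
    rw [hμ, ← volume_pi, lintegral_prod _ hfe.aemeasurable] at h
    rw [← h]
    simp only [e, MeasurableEquiv.symm_apply_apply]
  have hfix : ∀ x, ∫⁻ Z, f Z ∂(lastFixed d (n + 1) x) =
      ∫⁻ v, ∫⁻ W : Fin n → Phase d, f (e.symm ((x, v), W)) := by
    intro x
    unfold lastFixed
    rw [hsplit]
    · simp only [Fin.val_last, Nat.add_sub_cancel, if_true]
      rw [lintegral_prod _ hg.aemeasurable]
      exact lintegral_dirac' x hg.lintegral_prod_right'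
    · intro i
      split_ifs <;> infer_instance
    · funext j
      simp [j.isLt.ne]
  simp only [hfix]
  have h := hsplit (fun _ => volume) (fun _ => inferInstance) rfl
  rw [← volume_pi] at h
  rw [h]
  exact (lintegral_prod _ hg.aemeasurable).symm

theorem integrable_pi_gibbs {n : ℕ} (hn : 1 ≤ n) {Φ : (Fin n → Phase d) → ℝ} (hΦ : Measurable Φ)
    {C : ℝ} (h : ∀ x : Torus d,
      ∫⁻ Z, ENNReal.ofReal (|Φ Z| * ∏ i, maxwellian d (Z i).2) ∂(lastFixed d n x)
        ≤ ENNReal.ofReal C) :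
    Integrable Φ (Measure.pi fun _ => gibbs d) := by
  obtain ⟨n, rfl⟩ := Nat.exists_eq_add_of_le' hn
  refine ⟨hΦ.aestronglyMeasurable, ?_⟩
  have hm := (measurable_prod_maxwellian (d := d) (n + 1)).ennreal_ofReal
  rw [HasFiniteIntegral, pi_gibbs_eq_withDensity,
    lintegral_withDensity_eq_lintegral_mul _ hm hΦ.enorm]
  have heq : ∀ Z : Fin (n + 1) → Phase d,
      ((fun Z : Fin (n + 1) → Phase d => ENNReal.ofReal (∏ i, maxwellian d (Z i).2)) *
        fun Z => ‖Φ Z‖ₑ) Z =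
        ENNReal.ofReal (|Φ Z| * ∏ i, maxwellian d (Z i).2) := fun Z => by
    rw [Pi.mul_apply, mul_comm, ENNReal.ofReal_mul (abs_nonneg _), Real.enorm_eq_ofReal_abs]
  simp only [heq]
  have hm' : Measurable fun Z : Fin (n + 1) → Phase d =>
      ENNReal.ofReal (|Φ Z| * ∏ i, maxwellian d (Z i).2) :=
    (hΦ.abs.mul (measurable_prod_maxwellian (n + 1))).ennreal_ofReal
  rw [← lintegral_lintegral_lastFixed hm']
  refine (lintegral_mono h).trans_lt ?_
  rw [lintegral_const, measure_univ, mul_one]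
  exact ENNReal.ofReal_lt_top

theorem mu_mul_overlap {ε : ℝ} (hε : 0 < ε) : mu d ε * (2 * ε) ^ d = 2 ^ d * ε := by
  unfold mu
  rw [mul_pow, neg_sub, zpow_sub₀ hε.ne', zpow_one, zpow_natCast]
  field_simp

end Gibbs

/-- The cluster expansion identity (3.9): for a symmetric `Φ_N` with
`sup_{x_N} ∫ |Φ_N| M^{⊗N} dX_{N−1} dV_N ≤ C₀^N ρ₀`, both series below converge
absolutely and
`(1/Z^ε) ∑_p (μ_ε^p/p!) ∫ 1_{D^ε_{N+p}} M^{⊗(N+p)} Φ_N(Z_N)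
  = ∑_p (μ_ε^p/p!) ∫ M^{⊗(N+p)} φ(Z_N,Z̄_p) 1_{D^ε_N}(Z_N) Φ_N(Z_N)`. -/
theorem stmt_9 (d : ℕ) (hd : 2 ≤ d) (C₀ : ℝ) (hC₀ : 0 < C₀) :
    ∃ ε₀ ∈ Set.Ioo (0 : ℝ) 1,
      ∀ ε : ℝ, 0 < ε → ε < ε₀ →
      ∀ N : ℕ, 1 ≤ N →
      ∀ ρ₀ : ℝ, 0 < ρ₀ →
      ∀ Φ : (Fin N → Phase d) → ℝ, Measurable Φ →
        (∀ σ : Equiv.Perm (Fin N), ∀ Z, Φ (Z ∘ σ) = Φ Z) →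
        (∀ x : Torus d,
          ∫⁻ Z, ENNReal.ofReal (|Φ Z| * ∏ i, maxwellian d (Z i).2) ∂(lastFixed d N x)
            ≤ ENNReal.ofReal (C₀ ^ N * ρ₀)) →
        Summable (fun p : ℕ =>
            |mu d ε ^ p / p.factorial *
              ∫ Z : Fin (N + p) → Phase d, hsWeight d ε Z * Φ (Z ∘ Fin.castAdd p)|) ∧
        Summable (fun p : ℕ =>
            |mu d ε ^ p / p.factorial *
              ∫ Z : Fin (N + p) → Phase d,
                (∏ i, maxwellian d (Z i).2) *
                  cumulant d ε (Z ∘ Fin.castAdd p) (Z ∘ Fin.natAdd N) *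
                  (if HardCore d ε (Z ∘ Fin.castAdd p) then 1 else 0) *
                  Φ (Z ∘ Fin.castAdd p)|) ∧
        (partitionFn d ε)⁻¹ *
            (∑' p : ℕ, mu d ε ^ p / p.factorial *
              ∫ Z : Fin (N + p) → Phase d, hsWeight d ε Z * Φ (Z ∘ Fin.castAdd p)) =
          ∑' p : ℕ, mu d ε ^ p / p.factorial *
            ∫ Z : Fin (N + p) → Phase d,
              (∏ i, maxwellian d (Z i).2) *
                cumulant d ε (Z ∘ Fin.castAdd p) (Z ∘ Fin.natAdd N) *
                (if HardCore d ε (Z ∘ Fin.castAdd p) then 1 else 0) *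
                Φ (Z ∘ Fin.castAdd p) := by
  have h2d : (0 : ℝ) < 2 + 2 ^ d * exp 1 := by positivity
  refine ⟨1 / (2 + 2 ^ d * exp 1), ⟨by positivity, ?_⟩, ?_⟩
  · rw [div_lt_one h2d]
    have : (0 : ℝ) < 2 ^ d * exp 1 := by positivity
    linarith
  intro ε hε hε₀ N hN ρ₀ _ Φ hΦ _ hbound
  have hmb : mu d ε * (2 * ε) ^ d * exp 1 < 1 := by
    rw [mu_mul_overlap hε]
    rw [lt_div_iff₀ h2d] at hε₀
    nlinarith
  have h := cluster_expansion (ν := gibbs d) (D := Overlap ε) (measurableSet_overlap_pair ε)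
    overlap_symm (b := (2 * ε) ^ d) (by positivity) (gibbs_overlap_le hε.le)
    (m := mu d ε) (zpow_nonneg hε.le _) hmb hΦ (integrable_pi_gibbs hN hΦ hbound)
  have hI : ∀ p, coreIntegral (gibbs d) (Overlap ε) Φ p =
      ∫ Z : Fin (N + p) → Phase d, hsWeight d ε Z * Φ (Z ∘ Fin.castAdd p) := fun p => by
    rw [coreIntegral, integral_pi_gibbs]
    refine integral_congr_ae (ae_of_all _ fun Z => ?_)
    dsimp only
    rw [hsWeight, hardCore_ite_eq]
    ring
  have hQ : ∀ q, partitionIntegral (gibbs d) (Overlap ε) q =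
      ∫ Z : Fin q → Phase d, hsWeight d ε Z := fun q => by
    rw [partitionIntegral, integral_pi_gibbs]
    refine integral_congr_ae (ae_of_all _ fun Z => ?_)
    dsimp only
    rw [hsWeight, hardCore_ite_eq, mul_comm]
  have hJ : ∀ p, truncIntegral (gibbs d) (Overlap ε) Φ p =
      ∫ Z : Fin (N + p) → Phase d, (∏ i, maxwellian d (Z i).2) *
        cumulant d ε (Z ∘ Fin.castAdd p) (Z ∘ Fin.natAdd N) *
        (if HardCore d ε (Z ∘ Fin.castAdd p) then 1 else 0) *
        Φ (Z ∘ Fin.castAdd p) := fun p => by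
    rw [truncIntegral, integral_pi_gibbs]
    refine integral_congr_ae (ae_of_all _ fun Z => ?_)
    dsimp only
    rw [cumulant_eq_truncWeight hN, hardCore_ite_eq]
    simp only [Function.comp_apply, mul_assoc]
  simp only [hI, hQ, hJ] at h
  exact h
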